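/- arXiv:1408.4716 — 3 statements merged into one kernel-verified Lean document; each statement's English description precedes it below -/
import Mathlib

section
/- Let k ≥ 2 and let κ be an infinite cardinal. There exist m < ω and, for each j < m, a natural number e_j with 1 ≤ e_j ≤ k−1 and an e_j-dimensional k-template P_j of e_j-tuples of reals, such that for every algebraic k-hypergraph H: χ(H) ≤ κ if and only if H does not contain any L(ℝ^{e_j},P_j) for j < m. -/
open Cardinal

/-- A hypergraph with vertex type `V` is identified with its set of edges
`E : Set (Set V)`.  It is `κ`-colorable if there is a function from `V` to a
set of cardinality at most `κ` that is not constant on any edge. -/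
def HGColorable {V : Type} (E : Set (Set V)) (κ : Cardinal) : Prop :=
  ∃ (α : Type) (φ : V → α), #α ≤ κ ∧ ∀ e ∈ E, ∃ x ∈ e, ∃ y ∈ e, φ x ≠ φ y

/-- The chromatic number of a hypergraph: the least cardinal `κ` such that it
has a proper `κ`-coloring. -/
noncomputable def chrNum {V : Type} (E : Set (Set V)) : Cardinal :=
  sInf {κ | HGColorable E κ}

/-- `cardSucc κ m = κ^{+m}`, the `m`-fold cardinal successor of `κ`. -/
noncomputable def cardSucc (κ : Cardinal) (m : ℕ) : Cardinal := (Order.succ)^[m] κ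

/-- `Q` is a homomorphic image of the set `P` of `d`-tuples: there is a
surjection `f : P → Q` such that `x i = y i` implies `f x i = f y i`. -/
def IsHomImage {d : ℕ} {A : Type} {B : Fin d → Type} (P : Set (Fin d → A))
    (Q : Set (∀ i, B i)) : Prop :=
  ∃ f : (Fin d → A) → (∀ i, B i),
    Set.MapsTo f P Q ∧ Set.SurjOn f P Q ∧
    ∀ x ∈ P, ∀ y ∈ P, ∀ i, x i = y i → f x i = f y i

/-- The edges of the template hypergraph `L(X, P)` where `X = Π i, B i`:
the `k`-element subsets of the vertex set that are homomorphic images of `P`. -/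
def templateEdges (k : ℕ) {d : ℕ} {A : Type} {B : Fin d → Type}
    (P : Set (Fin d → A)) : Set (Set (∀ i, B i)) :=
  {Q | Q.ncard = k ∧ IsHomImage P Q}

/-- `I` is a distinguisher for `P`: any two distinct members of `P` differ at
some coordinate in `I`. -/
def IsDistinguisher {d : ℕ} {A : Type} (P : Set (Fin d → A)) (I : Finset (Fin d)) : Prop :=
  ∀ x ∈ P, ∀ y ∈ P, x ≠ y → ∃ i ∈ I, x i ≠ y i

/-- `eDim P = e(P)`, the least cardinality of a distinguisher for `P`. -/
noncomputable def eDim {d : ℕ} {A : Type} (P : Set (Fin d → A)) : ℕ :=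
  sInf {e | ∃ I : Finset (Fin d), IsDistinguisher P I ∧ I.card = e}

/-- A `d`-dimensional template is simple if for every `m < d` there are
`x, y ∈ P` with `x i = y i` exactly when `i ≠ m`. -/
def IsSimple {d : ℕ} {A : Type} (P : Set (Fin d → A)) : Prop :=
  ∀ m : Fin d, ∃ x ∈ P, ∃ y ∈ P, ∀ i, (x i = y i ↔ i ≠ m)

/-- The edges of the zero hypergraph of a `(k, n)`-ary real polynomial:
`k`-element subsets `{a_0, …, a_{k-1}}` of `ℝⁿ` with `p(a_0, …, a_{k-1}) = 0`
for some ordering of the elements. -/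
def zeroEdges {n k : ℕ} (p : MvPolynomial (Fin k × Fin n) ℝ) :
    Set (Set (Fin n → ℝ)) :=
  {A | ∃ a : Fin k → (Fin n → ℝ), Function.Injective a ∧ A = Set.range a ∧
        MvPolynomial.eval (fun q => a q.1 q.2) p = 0}

/-- `H₂ = (V₂, E₂)` contains (a copy of) `H₁ = (V₁, E₁)`: some injection
`V₁ → V₂` maps every edge of `H₁` onto an edge of `H₂`. -/
def HGContains {V₁ V₂ : Type} (E₁ : Set (Set V₁)) (E₂ : Set (Set V₂)) : Prop :=
  ∃ f : V₁ → V₂, Function.Injective f ∧ ∀ e ∈ E₁, f '' e ∈ E₂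

/-- The ring of real-valued functions on `W` that extend to functions analytic near `W`. -/
def analyticRing {V : Type} [Fintype V] (W : Set (V → ℝ)) : Subalgebra ℝ (W → ℝ) where
  carrier := {f | ∃ F : (V → ℝ) → ℝ, AnalyticOnNhd ℝ F W ∧ ∀ x : W, f x = F x}
  mul_mem' := by
    rintro f g ⟨F, hF, hf⟩ ⟨G, hG, hg⟩
    exact ⟨F * G, hF.mul hG, fun x => by simp [hf, hg]⟩
  add_mem' := by
    rintro f g ⟨F, hF, hf⟩ ⟨G, hG, hg⟩
    exact ⟨F + G, hF.add hG, fun x => by simp [hf, hg]⟩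
  algebraMap_mem' r := ⟨fun _ => r, analyticOnNhd_const, fun _ => rfl⟩

namespace analyticRing

variable {V : Type} [Fintype V] {W : Set (V → ℝ)} {K : Type} [Field K] [Algebra K ℝ]

/-- The coordinate functions. -/
def coord (W : Set (V → ℝ)) (v : V) : analyticRing W :=
  ⟨fun ω => ω.1 v, fun ω => ω v,
    (ContinuousLinearMap.proj (R := ℝ) (φ := fun _ : V => ℝ) v).analyticOnNhd W, fun _ => rfl⟩

/-- Evaluation at a point of `W`. -/
def evalAt (ω : W) : analyticRing W →+* ℝ :=
  (Pi.evalRingHom (fun _ : W => ℝ) ω).comp (analyticRing W).val.toRingHom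

lemma evalAt_apply (ω : W) (f : analyticRing W) : evalAt ω f = f.1 ω := rfl

/-- Polynomials in the coordinates act on analytic functions. -/
noncomputable instance : Algebra (MvPolynomial V K) (analyticRing W) :=
  (MvPolynomial.eval₂Hom ((algebraMap ℝ (analyticRing W)).comp (algebraMap K ℝ))
    (coord W)).toAlgebra

lemma evalAt_algebraMap (ω : W) (q : MvPolynomial V K) :
    evalAt ω (algebraMap _ (analyticRing W) q) = MvPolynomial.aeval ω.1 q := by
  have : (evalAt ω).comp (algebraMap (MvPolynomial V K) (analyticRing W))
      = (MvPolynomial.aeval ω.1 : MvPolynomial V K →ₐ[K] ℝ).toRingHom := by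
    apply MvPolynomial.ringHom_ext
    · intro r
      simp [RingHom.algebraMap_toAlgebra]
      rfl
    · intro v
      simp [RingHom.algebraMap_toAlgebra]
      rfl
  exact congrArg (fun h => h q) this

lemma isDomain (hW : IsOpen W) (hc : IsPreconnected W) (hne : W.Nonempty) :
    IsDomain (analyticRing W) := by
  have : Nontrivial (analyticRing W) := by
    obtain ⟨ω, hω⟩ := hne
    exact (evalAt ⟨ω, hω⟩).domain_nontrivial
  have : NoZeroDivisors (analyticRing W) := by
    constructor
    intro f g h
    obtain ⟨F, hF, hf⟩ := f.2
    obtain ⟨G, hG, hg⟩ := g.2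
    by_contra! hn
    obtain ⟨hf0, hg0⟩ := hn
    have : ∃ ω : W, f.1 ω ≠ 0 := by
      by_contra! hh
      exact hf0 (Subtype.ext (funext hh))
    obtain ⟨ω, hω⟩ := this
    apply hg0
    have hev : ∀ᶠ x in nhds ω.1, G x = 0 := by
      have h1 : ∀ᶠ x in nhds ω.1, F x ≠ 0 :=
        (hF ω ω.2).continuousAt.eventually_ne (by rwa [← hf])
      filter_upwards [h1, hW.mem_nhds ω.2] with x hx hxW
      have h2 : f.1 ⟨x, hxW⟩ * g.1 ⟨x, hxW⟩ = 0 := congrFun (congrArg Subtype.val h) ⟨x, hxW⟩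
      rw [hf, hg] at h2
      exact (mul_eq_zero.1 h2).resolve_left hx
    have := hG.eqOn_zero_of_preconnected_of_eventuallyEq_zero hc ω.2 hev
    apply Subtype.ext
    funext x
    rw [hg]
    exact this x.2
  exact NoZeroDivisors.to_isDomain _

lemma algebraMap_injective (hW : IsOpen W) (hne : W.Nonempty) :
    Function.Injective (algebraMap (MvPolynomial V K) (analyticRing W)) := by
  rw [injective_iff_map_eq_zero]
  intro q hq
  obtain ⟨ω, hω⟩ := hne
  obtain ⟨ε, hε, hb⟩ := Metric.isOpen_iff.1 hW ω hω
  have : MvPolynomial.map (algebraMap K ℝ) q = 0 := by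
    refine MvPolynomial.funext_set (fun v => Metric.ball (ω v) ε)
      (fun v => ?_) (fun x hx => ?_)
    · rw [Real.ball_eq_Ioo]
      exact Set.Ioo_infinite (by linarith)
    · have hx' : x ∈ W := hb (by rw [ball_pi _ hε]; exact hx)
      have := evalAt_algebraMap ⟨x, hx'⟩ q
      rw [hq, map_zero] at this
      rw [MvPolynomial.eval_map, map_zero, this]
      rfl
  exact (map_eq_zero_iff _ (MvPolynomial.map_injective _ (algebraMap K ℝ).injective)).1 this

lemma countable_isAlgebraic [Countable K] (hW : IsOpen W) (hc : IsPreconnected W) :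
    {g : analyticRing W | IsAlgebraic (MvPolynomial V K) g}.Countable := by
  rcases W.eq_empty_or_nonempty with rfl | hne
  · have : Subsingleton (analyticRing (∅ : Set (V → ℝ))) :=
      ⟨fun f g => Subtype.ext (funext fun x => x.2.elim)⟩
    exact (Set.subsingleton_of_subsingleton).countable
  · have := isDomain hW hc hne
    have : Module.IsTorsionFree (MvPolynomial V K) (analyticRing W) :=
      Module.isTorsionFree_iff_algebraMap_injective.2 (algebraMap_injective hW hne)
    have : Countable (MvPolynomial V K) := by
      rw [← Cardinal.mk_le_aleph0_iff]
      exact MvPolynomial.cardinalMk_le_max.trans (by simp)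
    exact Algebraic.countable _ _

lemma eq_zero_of_evalAt_eq_zero (hW : IsOpen W) (hc : IsPreconnected W) (ω : W)
    (hω : AlgebraicIndependent K ω.1) {g : analyticRing W}
    (hg : IsAlgebraic (MvPolynomial V K) g) (h0 : evalAt ω g = 0) : g = 0 := by
  have := isDomain hW hc ⟨ω, ω.2⟩
  by_contra hne
  obtain ⟨r, hr, hrg⟩ :=
    hg.exists_nonzero_coeff_and_aeval_eq_zero (mem_nonZeroDivisors_of_ne_zero hne)
  apply hr
  have h1 := congrArg (evalAt ω) hrg
  rw [Polynomial.aeval_def, Polynomial.hom_eval₂, h0, Polynomial.eval₂_at_zero, map_zero,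
    RingHom.comp_apply, evalAt_algebraMap] at h1
  exact (injective_iff_map_eq_zero _).1 hω _ h1

/-- Precomposition with a reindexing of the coordinates. -/
def pullback {V' : Type} [Fintype V'] {W' : Set (V' → ℝ)} (c : V → V')
    (h : ∀ ω ∈ W', ω ∘ c ∈ W) : analyticRing W →+* analyticRing W' where
  toFun f := ⟨fun ω => f.1 ⟨ω.1 ∘ c, h _ ω.2⟩, by
    obtain ⟨f, F, hF, hf⟩ := f
    let L : (V' → ℝ) →L[ℝ] (V → ℝ) :=
      ContinuousLinearMap.pi fun v => ContinuousLinearMap.proj (c v)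
    exact ⟨F ∘ L, fun ω hω => AnalyticAt.comp (hF _ (h ω hω)) (L.analyticAt ω),
      fun ω => hf _⟩⟩
  map_one' := rfl
  map_mul' _ _ := rfl
  map_zero' := rfl
  map_add' _ _ := rfl

lemma evalAt_pullback {V' : Type} [Fintype V'] {W' : Set (V' → ℝ)} (c : V → V')
    (h : ∀ ω ∈ W', ω ∘ c ∈ W) (ω : W') (f : analyticRing W) :
    evalAt ω (pullback c h f) = evalAt ⟨ω.1 ∘ c, h _ ω.2⟩ f := rfl

lemma isAlgebraic_pullback {V' : Type} [Fintype V'] {W' : Set (V' → ℝ)} (c : V → V')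
    (h : ∀ ω ∈ W', ω ∘ c ∈ W) (hc : Function.Injective c) {f : analyticRing W}
    (hf : IsAlgebraic (MvPolynomial V K) f) :
    IsAlgebraic (MvPolynomial V' K) (pullback c h f) := by
  refine hf.ringHom_of_comp_eq (MvPolynomial.rename (R := K) c) (pullback c h)
    (MvPolynomial.rename_injective c hc) ?_
  refine RingHom.ext fun q => ?_
  apply Subtype.ext
  funext ω
  rw [← evalAt_apply, ← evalAt_apply, RingHom.comp_apply, RingHom.comp_apply, RingHom.coe_coe,
    RingHom.coe_coe, evalAt_pullback, evalAt_algebraMap, evalAt_algebraMap]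
  exact MvPolynomial.aeval_rename _ _ _

/-- Substituting algebraic functions into a polynomial gives an algebraic function. -/
lemma exists_isAlgebraic_aeval [IsDomain (analyticRing W)] {σ : Type} (p : MvPolynomial σ K)
    (g : σ → analyticRing W) (hg : ∀ s, IsAlgebraic (MvPolynomial V K) (g s)) :
    ∃ G : analyticRing W, IsAlgebraic (MvPolynomial V K) G ∧
      ∀ ω, evalAt ω G = MvPolynomial.aeval (fun s => evalAt ω (g s)) p := by
  induction p using MvPolynomial.induction_on with
  | C a =>
    refine ⟨algebraMap _ _ (MvPolynomial.C a), isAlgebraic_algebraMap _, fun ω => ?_⟩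
    rw [evalAt_algebraMap]
    simp
  | add p q hp hq =>
    obtain ⟨P, hP, hP'⟩ := hp
    obtain ⟨Q, hQ, hQ'⟩ := hq
    exact ⟨P + Q, hP.add hQ, fun ω => by simp [hP', hQ']⟩
  | mul_X p s hp =>
    obtain ⟨P, hP, hP'⟩ := hp
    exact ⟨P * g s, hP.mul (hg s), fun ω => by simp [hP']⟩

end analyticRing

namespace analyticRing

variable {V : Type} [Fintype V] {W : Set (V → ℝ)} {K : Type} [Field K] [Algebra K ℝ]

/-- The extension by zero of an element of `analyticRing W`. -/
noncomputable def ev (f : analyticRing W) : (V → ℝ) → ℝ := Function.extend Subtype.val f.1 0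

lemma ev_eq (f : analyticRing W) {x : V → ℝ} (hx : x ∈ W) : ev f x = evalAt ⟨x, hx⟩ f :=
  Subtype.val_injective.extend_apply f.1 0 ⟨x, hx⟩

end analyticRing

open analyticRing

/-- The open box whose sides are the given rational intervals. -/
def ratBox {d : ℕ} (β : Fin d → ℚ × ℚ) : Set (Fin d → ℝ) :=
  Set.univ.pi fun i => Set.Ioo ((β i).1 : ℝ) ((β i).2 : ℝ)

lemma isOpen_ratBox {d : ℕ} (β : Fin d → ℚ × ℚ) : IsOpen (ratBox β) :=
  isOpen_set_pi Set.finite_univ fun _ _ => isOpen_Ioo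

lemma convex_ratBox {d : ℕ} (β : Fin d → ℚ × ℚ) : Convex ℝ (ratBox β) :=
  convex_pi fun _ _ => convex_Ioo _ _

lemma exists_ratBox {d : ℕ} {x : Fin d → ℝ} {U : Set (Fin d → ℝ)} (hU : U ∈ nhds x) :
    ∃ β : Fin d → ℚ × ℚ, x ∈ ratBox β ∧ ratBox β ⊆ U := by
  obtain ⟨ε, hε, hb⟩ := Metric.mem_nhds_iff.1 hU
  have h (i : Fin d) : ∃ q : ℚ × ℚ, x i - ε < q.1 ∧ (q.1 : ℝ) < x i ∧ x i < q.2 ∧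
      (q.2 : ℝ) < x i + ε := by
    obtain ⟨a, ha, ha'⟩ := exists_rat_btwn (show x i - ε < x i by linarith)
    obtain ⟨b, hb, hb'⟩ := exists_rat_btwn (show x i < x i + ε by linarith)
    exact ⟨(a, b), ha, ha', hb, hb'⟩
  choose β h1 h2 h3 h4 using h
  refine ⟨β, fun i _ => ⟨h2 i, h3 i⟩, fun y hy => hb ?_⟩
  rw [ball_pi _ hε]
  intro i _
  have := hy i trivial
  change y i ∈ Metric.ball (x i) ε
  rw [Real.ball_eq_Ioo]
  exact ⟨(h1 i).trans this.1, this.2.trans (h4 i)⟩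

/-- A polynomial relation between values of algebraic analytic functions that holds at one
configuration of algebraically independent points holds at every configuration having at least
the same coincidences between coordinates. -/
lemma aeval_ev_eq_zero_of_generic {K : Type} [Field K] [Algebra K ℝ] {ι : Type} {τ : ι → ℝ}
    (hτ : AlgebraicIndependent K τ) {d : ℕ} {β : Fin d → ℚ × ℚ} {σ κ : Type} [Finite κ]
    (g : σ → analyticRing (ratBox β)) (hg : ∀ l, IsAlgebraic (MvPolynomial (Fin d) K) (g l))
    (p : MvPolynomial (κ × σ) K) (t : κ → Fin d → ι) (htB : ∀ j, τ ∘ t j ∈ ratBox β)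
    (hdisj : ∀ j l i i', t j i = t l i' → i = i')
    (h0 : MvPolynomial.aeval (fun q : κ × σ => ev (g q.2) (τ ∘ t q.1)) p = 0)
    (u : κ → Fin d → ℝ) (hu : ∀ j, u j ∈ ratBox β)
    (hcomp : ∀ j l i, t j i = t l i → u j i = u l i) :
    MvPolynomial.aeval (fun q : κ × σ => ev (g q.2) (u q.1)) p = 0 := by
  classical
  let V : Set ι := Set.range fun q : κ × Fin d => t q.1 q.2
  have : Fintype V := (Set.finite_range _).fintype
  let c (j : κ) (i : Fin d) : V := ⟨t j i, ⟨(j, i), rfl⟩⟩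
  let W : Set (V → ℝ) := ⋂ j, {ω | ω ∘ c j ∈ ratBox β}
  have hW : IsOpen W := isOpen_iInter_of_finite fun j =>
    (isOpen_ratBox β).preimage (by fun_prop : Continuous fun ω : V → ℝ => ω ∘ c j)
  have hWc : IsPreconnected W := by
    refine (convex_iInter fun j => ?_).isPreconnected
    exact (convex_ratBox β).linear_preimage (LinearMap.funLeft ℝ ℝ (c j))
  have hWB (j : κ) : ∀ ω ∈ W, ω ∘ c j ∈ ratBox β := fun ω hω => Set.mem_iInter.1 hω j
  have hci (j : κ) : Function.Injective (c j) := fun i i' h =>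
    hdisj j j i i' (congrArg Subtype.val h)
  let ω₀ : W := ⟨fun v => τ v.1, Set.mem_iInter.2 htB⟩
  have hω₀ : AlgebraicIndependent K ω₀.1 := hτ.comp _ Subtype.val_injective
  have hsel (v : V) : ∃ q : κ × Fin d, t q.1 q.2 = v := v.2
  choose s hs using hsel
  let ω₁ : V → ℝ := fun v => u (s v).1 (s v).2
  have hω₁c (j : κ) : ω₁ ∘ c j = u j := by
    funext i
    have h1 := hs (c j i)
    have h2 := hdisj _ _ _ _ h1
    change u (s (c j i)).1 (s (c j i)).2 = u j i
    rw [h2] at h1 ⊢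
    exact hcomp _ _ _ h1
  have hω₁ : ω₁ ∈ W := Set.mem_iInter.2 fun j => by
    change ω₁ ∘ c j ∈ ratBox β
    rw [hω₁c]
    exact hu j
  have := isDomain hW hWc ⟨ω₁, hω₁⟩
  obtain ⟨G, hG, hG'⟩ := exists_isAlgebraic_aeval (W := W) p
    (fun q => pullback (c q.1) (hWB q.1) (g q.2))
    (fun q => isAlgebraic_pullback _ _ (hci q.1) (hg q.2))
  have hev (ω : W) : evalAt ω G =
      MvPolynomial.aeval (fun q : κ × σ => ev (g q.2) (ω.1 ∘ c q.1)) p := by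
    rw [hG']
    congr! 2
    funext q
    rw [evalAt_pullback, ev_eq]
  have hG0 : G = 0 := eq_zero_of_evalAt_eq_zero hW hWc ω₀ hω₀ hG (by rw [hev]; exact h0)
  have := hev ⟨ω₁, hω₁⟩
  rw [hG0, map_zero] at this
  simpa only [hω₁c] using this.symm

/-- A polynomial relation can be chosen with nonvanishing derivative at the root. -/
lemma exists_eval₂_derivative_ne_zero {S : Type} [CommRing S] [CharZero S] [IsDomain S]
    (θ : S →+* ℝ) (hθ : Function.Injective θ) (y : ℝ) (q : Polynomial S) (hq : q ≠ 0)
    (hy : q.eval₂ θ y = 0) :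
    ∃ q : Polynomial S, q.eval₂ θ y = 0 ∧ q.derivative.eval₂ θ y ≠ 0 := by
  induction hn : q.natDegree using Nat.strong_induction_on generalizing q with
  | _ n ih =>
    by_cases h : q.derivative.eval₂ θ y = 0
    · have hdeg : q.natDegree ≠ 0 := by
        intro h0
        rw [Polynomial.eq_C_of_natDegree_eq_zero h0] at hy hq
        rw [Polynomial.eval₂_C] at hy
        apply hq
        rw [(injective_iff_map_eq_zero θ).1 hθ _ hy, map_zero]
      exact ih _ (hn ▸ Polynomial.natDegree_derivative_lt hdeg) q.derivative
        (fun h0 => hdeg (Polynomial.derivative_eq_zero.1 h0)) h rfl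
    · exact ⟨q, hy, h⟩

/-- A number algebraic over a generic point is the value there of an algebraic function analytic
near that point. -/
lemma exists_analytic_root {V K : Type} [Fintype V] [Field K] [Algebra K ℝ] {ω₀ : V → ℝ}
    (hω : AlgebraicIndependent K ω₀) {y : ℝ}
    (hy : IsAlgebraic (Algebra.adjoin K (Set.range ω₀)) y) :
    ∃ F : (V → ℝ) → ℝ, F ω₀ = y ∧ (∀ᶠ ω in nhds ω₀, AnalyticAt ℝ F ω) ∧
      ∃ q : Polynomial (MvPolynomial V K), q ≠ 0 ∧
        ∀ᶠ ω in nhds ω₀, q.eval₂ (MvPolynomial.aeval ω).toRingHom (F ω) = 0 := by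
  have hchar : CharZero K := (algebraMap K ℝ).charZero
  let θ (ω : V → ℝ) : MvPolynomial V K →+* ℝ := (MvPolynomial.aeval ω).toRingHom
  obtain ⟨q₀, hq₀, hq₀'⟩ : ∃ q : Polynomial (MvPolynomial V K), q ≠ 0 ∧
      q.eval₂ (θ ω₀) y = 0 := by
    let : Algebra (MvPolynomial V K) ℝ := (θ ω₀).toAlgebra
    have : IsAlgebraic (MvPolynomial V K) (RingHom.id ℝ y) := by
      refine hy.ringHom_of_comp_eq (hω.aevalEquiv.symm : _ →+* _) (RingHom.id ℝ)
        hω.aevalEquiv.symm.injective ?_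
      refine RingHom.ext fun a => ?_
      obtain ⟨b, rfl⟩ := hω.aevalEquiv.surjective a
      simp [RingHom.algebraMap_toAlgebra, θ]
    exact this
  obtain ⟨q, hq, hq'⟩ := exists_eval₂_derivative_ne_zero (θ ω₀) hω y q₀ hq₀ hq₀'
  let f : (V → ℝ) × ℝ → ℝ := fun x => q.eval₂ (θ x.1) x.2
  have hf : ContDiffAt ℝ (⊤ : WithTop ℕ∞) f (ω₀, y) := by
    have : f = fun x => ∑ i ∈ Finset.range (q.natDegree + 1),
        MvPolynomial.aeval x.1 (q.coeff i) * x.2 ^ i := by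
      funext x
      exact Polynomial.eval₂_eq_sum_range _ _
    rw [this]
    refine AnalyticAt.contDiffAt (Finset.analyticAt_fun_sum _ fun i _ => ?_)
    refine AnalyticAt.mul ?_ (analyticAt_snd.pow i)
    refine AnalyticAt.aeval_mvPolynomial (fun v => ?_) _
    exact ((ContinuousLinearMap.proj (R := ℝ) (φ := fun _ : V => ℝ) v).comp
      (ContinuousLinearMap.fst ℝ (V → ℝ) ℝ)).analyticAt _
  have hd : (fderiv ℝ f (ω₀, y) ∘L .inr ℝ (V → ℝ) ℝ) 1 = q.derivative.eval₂ (θ ω₀) y := by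
    have h1 : HasFDerivAt (fun z : ℝ => f (ω₀, z))
        (fderiv ℝ f (ω₀, y) ∘L .inr ℝ (V → ℝ) ℝ) y :=
      HasFDerivAt.comp y (hf.differentiableAt (by simp)).hasFDerivAt
        (hasFDerivAt_prodMk_right ω₀ y)
    have h2 : HasDerivAt (fun z : ℝ => f (ω₀, z)) ((q.map (θ ω₀)).derivative.eval y) y := by
      have := (q.map (θ ω₀)).hasDerivAt y
      simpa only [Polynomial.eval_map] using this
    rw [h1.hasDerivAt.unique h2, Polynomial.derivative_map, Polynomial.eval_map]
  have hinv : (fderiv ℝ f (ω₀, y) ∘L .inr ℝ (V → ℝ) ℝ).IsInvertible := by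
    refine ⟨ContinuousLinearEquiv.unitsEquivAut ℝ (Units.mk0 _ (hd ▸ hq')), ?_⟩
    ext
    simp
  refine ⟨hf.implicitFunction (by simp) hinv, hf.implicitFunction_apply_self (by simp) hinv,
    ?_, q, ?_, ?_⟩
  · exact (hf.contDiffAt_implicitFunction (by simp) hinv).analyticAt.eventually_analyticAt
  · rintro rfl
    simp at hq'
  · filter_upwards [hf.eventually_apply_implicitFunction (by simp) hinv] with ω hω'
    exact hω'.trans hq

lemma exists_rat_mul_mem_Ioo {x a b : ℝ} (hx : x ≠ 0) (hab : a < b) :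
    ∃ r : ℚ, r ≠ 0 ∧ r * x ∈ Set.Ioo a b := by
  obtain ⟨y, hy, hy0⟩ := ((Set.Ioo_infinite hab).sdiff (Set.finite_singleton (0 : ℝ))).nonempty
  let U : Set ℝ := {r | r * x ∈ Set.Ioo a b} ∩ {0}ᶜ
  have hU : IsOpen U :=
    (isOpen_Ioo.preimage (continuous_mul_const x)).inter isOpen_compl_singleton
  obtain ⟨r, hr⟩ := Rat.denseRange_cast.exists_mem_open hU
    ⟨y / x, by simpa [div_mul_cancel₀ _ hx] using hy, by simpa [hx] using hy0⟩
  exact ⟨r, by simpa using hr.2, hr.1⟩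

/-- There is a transcendence basis of `ℝ` with continuum many members in each interval. -/
lemma exists_spread_basis (K : Type) [Field K] [Algebra K ℝ] [Countable K] :
    ∃ τ : ℝ × ℚ × ℚ → ℝ, AlgebraicIndependent K τ ∧
      (∀ y : ℝ, IsAlgebraic (Algebra.adjoin K (Set.range τ)) y) ∧
      ∀ (s : ℝ) (a b : ℚ), a < b → τ (s, a, b) ∈ Set.Ioo (a : ℝ) b := by
  have hchar : CharZero K := (algebraMap K ℝ).charZero
  obtain ⟨ι, x, hx⟩ := exists_isTranscendenceBasis' K ℝ
  have hK : #K ≤ ℵ₀ := mk_le_aleph0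
  have hne : Nonempty ι := by
    by_contra h
    rw [not_nonempty_iff, hx.isEmpty_iff_isAlgebraic] at h
    have := Algebra.IsAlgebraic.cardinalMk_le_max K ℝ
    rw [max_eq_right hK, mk_real] at this
    exact this.not_gt aleph0_lt_continuum
  have hι : #(ℝ × ℚ × ℚ) = #ι := by
    have h := hx.lift_cardinalMk_eq_max_lift
    simp only [lift_id, mk_real] at h
    have h2 : max #K #ι ⊔ ℵ₀ = #ι ⊔ ℵ₀ := by
      rw [sup_right_comm, sup_eq_right.2 hK, sup_comm]
    rw [h2] at h
    have h3 : 𝔠 = #ι := by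
      rcases max_choice #ι ℵ₀ with h4 | h4
      · rw [h, h4]
      · exact absurd (h.trans h4) aleph0_lt_continuum.ne'
    rw [← h3]
    simp [mk_real]
  obtain ⟨e⟩ := Cardinal.eq.1 hι
  have hy := hx.comp_equiv e
  set y := x ∘ e with hye
  have hr (q : ℝ × ℚ × ℚ) : ∃ r : ℚ, r ≠ 0 ∧
      (q.2.1 < q.2.2 → r * y q ∈ Set.Ioo (q.2.1 : ℝ) q.2.2) := by
    by_cases h : q.2.1 < q.2.2
    · obtain ⟨r, h1, h2⟩ := exists_rat_mul_mem_Ioo (hy.1.ne_zero q) (Rat.cast_lt (K := ℝ).2 h)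
      exact ⟨r, h1, fun _ => h2⟩
    · exact ⟨1, one_ne_zero, fun h' => absurd h' h⟩
  choose r hr0 hrI using hr
  have hrK (q) : (algebraMap K ℝ) (r q : K) = r q := map_ratCast _ _
  refine ⟨fun q => r q * y q, ?_, ?_, fun s a b h => hrI (s, a, b) h⟩
  · have := hy.1.polynomial_aeval_of_transcendental
      (f := fun q => Polynomial.C (r q : K) * Polynomial.X) fun q => by
        have hq : (r q : K) ≠ 0 := Rat.cast_ne_zero.2 (hr0 q)
        apply Polynomial.transcendental
        · rw [Polynomial.natDegree_C_mul_X _ hq]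
          exact one_ne_zero
        · rw [Polynomial.leadingCoeff_C_mul_X]
          exact mem_nonZeroDivisors_of_ne_zero hq
    simpa [hrK] using this
  · have hle : Algebra.adjoin K (Set.range y) ≤
        Algebra.adjoin K (Set.range fun q => (r q : ℝ) * y q) := by
      rw [Algebra.adjoin_le_iff]
      rintro _ ⟨q, rfl⟩
      have h1 := Subalgebra.smul_mem (Algebra.adjoin K (Set.range fun q => (r q : ℝ) * y q))
        (Algebra.subset_adjoin ⟨q, rfl⟩) ((r q : K)⁻¹)
      have h0 : (r q : ℝ) ≠ 0 := Rat.cast_ne_zero.2 (hr0 q)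
      simpa [Algebra.smul_def, hrK, h0] using h1
    intro z
    have hz := hy.isAlgebraic.isAlgebraic z
    exact hz.ringHom_of_comp_eq (Subalgebra.inclusion hle).toRingHom (RingHom.id ℝ)
      (Subalgebra.inclusion_injective hle) rfl

/-- Finitely many numbers algebraic over a family are algebraic over a finite subfamily. -/
lemma exists_finset_isAlgebraic {K ι : Type} [Field K] [Algebra K ℝ] {τ : ι → ℝ}
    (h : ∀ y : ℝ, IsAlgebraic (Algebra.adjoin K (Set.range τ)) y) {n : ℕ} (x : Fin n → ℝ) :
    ∃ S : Finset ι, ∀ l, IsAlgebraic (Algebra.adjoin K (τ '' S)) (x l) := by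
  classical
  let M := AlgebraicIndependent.matroid K ℝ
  have hM (s : Set ℝ) (y : ℝ) : y ∈ M.closure s ↔ IsAlgebraic (Algebra.adjoin K s) y := by
    rw [AlgebraicIndependent.matroid_closure_eq]
    rfl
  have hS (l : Fin n) : ∃ S : Finset ι, x l ∈ M.closure (τ '' S) := by
    obtain ⟨I, hI, hf, -, hx⟩ :=
      Matroid.exists_mem_finite_closure_of_mem_closure ((hM _ _).2 (h (x l)))
    lift I to Finset ℝ using hf
    rw [← Set.image_univ, Finset.subset_set_image_iff] at hI
    obtain ⟨S, -, rfl⟩ := hI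
    exact ⟨S, by simpa using hx⟩
  choose S hS using hS
  refine ⟨Finset.univ.biUnion S, fun l => (hM _ _).1 (M.closure_subset_closure ?_ (hS l))⟩
  apply Set.image_mono
  exact_mod_cast Finset.subset_biUnion_of_mem S (Finset.mem_univ l)

/-- Every finite tuple of reals is the value of a tuple of algebraic analytic functions at a
generic point with coordinates in a given transcendence basis. -/
lemma exists_representation {K ι : Type} [Field K] [Algebra K ℝ] {τ : ι → ℝ}
    (hτ : AlgebraicIndependent K τ)
    (h : ∀ y : ℝ, IsAlgebraic (Algebra.adjoin K (Set.range τ)) y) {n : ℕ} (x : Fin n → ℝ) :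
    ∃ (d : ℕ) (β : Fin d → ℚ × ℚ) (g : Fin n → analyticRing (ratBox β)) (t : Fin d → ι),
      (∀ l, IsAlgebraic (MvPolynomial (Fin d) K) (g l)) ∧ τ ∘ t ∈ ratBox β ∧
      (∀ u ∈ ratBox β, Function.Injective u) ∧ ∀ l, ev (g l) (τ ∘ t) = x l := by
  classical
  obtain ⟨S, hS⟩ := exists_finset_isAlgebraic h x
  let t : Fin S.card → ι := fun i => S.equivFin.symm i
  have ht : Function.Injective t := Subtype.val_injective.comp S.equivFin.symm.injective
  have hrange : Set.range (τ ∘ t) = τ '' S := by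
    rw [Set.range_comp]
    congr 1
    ext i
    exact ⟨fun ⟨j, hj⟩ => hj ▸ (S.equivFin.symm j).2,
      fun hi => ⟨S.equivFin ⟨i, hi⟩, by simp [t]⟩⟩
  have hω := hτ.comp t ht
  have hroot (l : Fin n) := exists_analytic_root hω (y := x l) (by rw [hrange]; exact hS l)
  choose F hF1 hF2 q hq hq' using hroot
  have hinj : ∀ᶠ ω : Fin S.card → ℝ in nhds (τ ∘ t), Function.Injective ω := by
    have : ∀ i j, i ≠ j → ∀ᶠ ω : Fin S.card → ℝ in nhds (τ ∘ t), ω i ≠ ω j := fun i j hij =>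
      (isOpen_ne_fun (continuous_apply i) (continuous_apply j)).mem_nhds
        fun he => hij (hω.injective he)
    simp only [← Filter.eventually_all] at this
    filter_upwards [this] with ω hω' i j hij
    by_contra hne
    exact hω' i j hne hij
  obtain ⟨β, hβ, hβU⟩ := exists_ratBox
    (((Filter.eventually_all.2 hF2).and (Filter.eventually_all.2 hq')).and hinj)
  refine ⟨S.card, β, fun l => ⟨fun ω => F l ω, F l, fun ω hω => (hβU hω).1.1 l, fun _ => rfl⟩, t,
    fun l => ⟨q l, hq l, ?_⟩, hβ, fun u hu => (hβU hu).2, fun l => ?_⟩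
  · refine Subtype.ext (funext fun ω => ?_)
    have := (hβU ω.2).1.2 l
    change evalAt ω _ = 0
    rw [Polynomial.aeval_def, Polynomial.hom_eval₂]
    have hcomp : (evalAt ω).comp (algebraMap (MvPolynomial (Fin S.card) K) _) =
        (MvPolynomial.aeval ω.1).toRingHom := RingHom.ext (evalAt_algebraMap ω)
    rw [hcomp]
    exact this
  · rw [ev_eq _ hβ, evalAt_apply]
    exact hF1 l

/-- Distinct coordinates of points in a box of injective tuples are distinct. -/
lemma eq_of_mem_ratBox {d : ℕ} {β : Fin d → ℚ × ℚ}
    (hβ : ∀ u ∈ ratBox β, Function.Injective u) {u v : Fin d → ℝ} (hu : u ∈ ratBox β)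
    (hv : v ∈ ratBox β) {i j : Fin d} (h : u i = v j) : i = j := by
  by_contra hij
  have hw : Function.update u j (v j) ∈ ratBox β := by
    intro l _
    by_cases hl : l = j
    · subst hl
      simpa using hv l trivial
    · rw [Function.update_of_ne hl]
      exact hu l trivial
  refine hij (hβ _ hw ?_)
  rw [Function.update_of_ne hij, Function.update_self, h]

/-- The coordinates in `J` determine the values of all the functions `g l` on the box. -/
def Determines {d n : ℕ} {β : Fin d → ℚ × ℚ} (g : Fin n → analyticRing (ratBox β))
    (J : Finset (Fin d)) : Prop :=
  ∀ u ∈ ratBox β, ∀ v ∈ ratBox β, (∀ i ∈ J, u i = v i) → ∀ l, ev (g l) u = ev (g l) v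

lemma exists_minimal_determines {d n : ℕ} {β : Fin d → ℚ × ℚ}
    (g : Fin n → analyticRing (ratBox β)) :
    ∃ J, Determines g J ∧ ∀ J', Determines g J' → J ⊆ J' := by
  classical
  have hinter (A B : Finset (Fin d)) (hA : Determines g A) (hB : Determines g B) :
      Determines g (A ∩ B) := by
    intro u hu v hv huv l
    let w : Fin d → ℝ := fun i => if i ∈ A then u i else v i
    have hw : w ∈ ratBox β := by
      intro i _
      by_cases hi : i ∈ A
      · simpa [w, hi] using hu i trivial
      · simpa [w, hi] using hv i trivial
    rw [hA u hu w hw (fun i hi => by simp [w, hi]) l]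
    refine hB w hw v hv (fun i hi => ?_) l
    by_cases hiA : i ∈ A
    · simpa [w, hiA] using huv i (Finset.mem_inter.2 ⟨hiA, hi⟩)
    · simp [w, hiA]
  have huniv : Determines g Finset.univ := fun u _ v _ huv l => by
    rw [show u = v from funext fun i => huv i (Finset.mem_univ i)]
  refine ⟨(Finset.univ.filter (Determines g)).inf id, ?_, fun J' hJ' => ?_⟩
  · refine Finset.inf_induction huniv (fun A hA B hB => hinter A B hA hB) fun A hA => ?_
    exact (Finset.mem_filter.1 hA).2
  · exact Finset.inf_le (f := id) (Finset.mem_filter.2 ⟨Finset.mem_univ _, hJ'⟩)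

/-- Generic points with equal values agree on a determining set of coordinates. -/
lemma determines_of_ev_eq {K ι : Type} [Field K] [Algebra K ℝ] {τ : ι → ℝ}
    (hτ : AlgebraicIndependent K τ) {d n : ℕ} {β : Fin d → ℚ × ℚ}
    (hβ : ∀ u ∈ ratBox β, Function.Injective u) {g : Fin n → analyticRing (ratBox β)}
    (hg : ∀ l, IsAlgebraic (MvPolynomial (Fin d) K) (g l)) {t t' : Fin d → ι}
    (ht : τ ∘ t ∈ ratBox β) (ht' : τ ∘ t' ∈ ratBox β)
    (h : ∀ l, ev (g l) (τ ∘ t) = ev (g l) (τ ∘ t')) {J : Finset (Fin d)}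
    (hJ : ∀ i, t i = t' i → i ∈ J) : Determines g J := by
  intro u hu v hv huv l
  have htB (b : Bool) : τ ∘ (bif b then t else t') ∈ ratBox β := by cases b <;> assumption
  have := aeval_ev_eq_zero_of_generic hτ g hg
    (MvPolynomial.X (true, l) - MvPolynomial.X (false, l)) (fun b : Bool => bif b then t else t')
    htB (fun b c i i' hi => eq_of_mem_ratBox hβ (htB b) (htB c) (congrArg τ hi))
    (by simp [h l]) (fun b : Bool => bif b then u else v) (by rintro (_ | _) <;> assumption)
    (by
      rintro (_ | _) (_ | _) i hi
      · rfl
      · exact (huv i (hJ i hi.symm)).symm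
      · exact huv i (hJ i hi)
      · rfl)
  simpa [sub_eq_zero] using this

/-- The template whose points are the tuples `σ j`, with entries regarded as reals. -/
def patternTemplate {k e : ℕ} (σ : Fin k → Fin e → Fin k) : Set (Fin e → ℝ) :=
  Set.range fun j i => ((σ j i : ℕ) : ℝ)

/-- An edge of generic points of the same type that are separated by necessary coordinates gives
rise to a copy of a template hypergraph. -/
lemma hgContains_of_edge {K : Type} [Field K] [Algebra K ℝ] {τ : ℝ × ℚ × ℚ → ℝ}
    (hτ : AlgebraicIndependent K τ)
    (hτI : ∀ (s : ℝ) (a b : ℚ), a < b → τ (s, a, b) ∈ Set.Ioo (a : ℝ) b) {d n k : ℕ} [NeZero k]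
    {β : Fin d → ℚ × ℚ} (hβ : ∀ u ∈ ratBox β, Function.Injective u)
    {g : Fin n → analyticRing (ratBox β)}
    (hg : ∀ l, IsAlgebraic (MvPolynomial (Fin d) K) (g l)) {J : Finset (Fin d)}
    (hJ : ∀ J', Determines g J' → J ⊆ J') (p : MvPolynomial (Fin k × Fin n) K)
    (t : Fin k → Fin d → ℝ × ℚ × ℚ) (htB : ∀ j, τ ∘ t j ∈ ratBox β)
    (h0 : MvPolynomial.aeval (fun q : Fin k × Fin n => ev (g q.2) (τ ∘ t q.1)) p = 0)
    {I : Finset (Fin d)} (hIJ : I ⊆ J)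
    (hI : ∀ j l, (∀ i ∈ I, t j i = t l i) → j = l) :
    ∃ σ : Fin k → Fin I.card → Fin k, Function.Injective σ ∧
      HGContains (templateEdges k (B := fun _ => ℝ) (patternTemplate σ))
        (zeroEdges (p.map (algebraMap K ℝ))) := by
  classical
  let e := I.equivFin
  let σ : Fin k → Fin I.card → Fin k := fun a m =>
    Function.invFun (fun b => t b (e.symm m)) (t a (e.symm m))
  have hσ (a m) : t (σ a m) (e.symm m) = t a (e.symm m) :=
    Function.invFun_eq (f := fun b => t b (e.symm m)) ⟨a, rfl⟩
  have hσ' (a b m) (h : t a (e.symm m) = t b (e.symm m)) : σ a m = σ b m := by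
    simp only [σ, h]
  refine ⟨σ, fun a b hab => hI a b fun i hi => ?_, ?_⟩
  · have h1 := hσ a (e ⟨i, hi⟩)
    have h2 := hσ b (e ⟨i, hi⟩)
    rw [hab, h2] at h1
    simpa using h1.symm
  let w : (Fin I.card → ℝ) → Fin d → ℝ × ℚ × ℚ := fun s i =>
    (if h : i ∈ I then s (e ⟨i, h⟩) else 0, β i)
  have hwB (s) : τ ∘ w s ∈ ratBox β := fun i _ => hτI _ _ _ <| by
    have := htB 0 i trivial
    exact_mod_cast this.1.trans this.2
  let f : (Fin I.card → ℝ) → Fin n → ℝ := fun s l => ev (g l) (τ ∘ w s)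
  have hf : Function.Injective f := fun s s' hss => by
    have hdet := hJ (Finset.univ.filter fun i => w s i = w s' i)
      (determines_of_ev_eq hτ hβ hg (hwB s) (hwB s') (congrFun hss) (by simp))
    funext m
    have hm := hdet (hIJ (e.symm m).2)
    simpa [w] using hm
  refine ⟨f, hf, ?_⟩
  rintro Q ⟨hQ, φ, hmaps, hsurj, hcomp⟩
  have hQ' : Q = Set.range fun j : Fin k => φ fun i => ((σ j i : ℕ) : ℝ) := by
    rw [← hsurj.image_eq_of_mapsTo hmaps, patternTemplate, ← Set.range_comp]
    rfl
  have hinj : Function.Injective fun j : Fin k => φ fun i => ((σ j i : ℕ) : ℝ) := by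
    rw [← Set.injOn_univ]
    refine Set.injOn_of_ncard_image_eq ?_
    rw [Set.image_univ, ← hQ', hQ, Set.ncard_univ, Nat.card_fin]
  refine ⟨_, hf.comp hinj, by rw [hQ', ← Set.range_comp], ?_⟩
  rw [MvPolynomial.eval_map, ← MvPolynomial.aeval_def]
  refine aeval_ev_eq_zero_of_generic hτ g hg p t htB
    (fun j l i i' hi => eq_of_mem_ratBox hβ (htB j) (htB l) (congrArg τ hi)) h0
    (fun j => τ ∘ w (φ fun i => ((σ j i : ℕ) : ℝ))) (fun j => hwB _) fun j l i hi => ?_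
  have hw : w (φ fun i => ((σ j i : ℕ) : ℝ)) i = w (φ fun i => ((σ l i : ℕ) : ℝ)) i := by
    by_cases hiI : i ∈ I
    · have h1 := hσ' j l (e ⟨i, hiI⟩) (by simpa using hi)
      have := hcomp _ ⟨j, rfl⟩ _ ⟨l, rfl⟩ (e ⟨i, hiI⟩) (by simp [h1])
      simp only [w, hiI, dite_true, this]
    · simp [w, hiI]
  exact congrArg τ hw

lemma cardSucc_succ (κ : Cardinal.{0}) (m : ℕ) : cardSucc κ (m + 1) = Order.succ (cardSucc κ m) :=
  Function.iterate_succ_apply' _ _ _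

lemma cardSucc_mono (κ : Cardinal.{0}) : Monotone (cardSucc κ) :=
  monotone_nat_of_le_succ fun m => by
    rw [cardSucc_succ]
    exact Order.le_succ _

lemma le_cardSucc (κ : Cardinal.{0}) (m : ℕ) : κ ≤ cardSucc κ m :=
  cardSucc_mono κ m.zero_le

/-- A set of size at most `μ⁺` is ordered so that each initial segment injects into `μ`. -/
lemma exists_initial_segment_injections {μ : Cardinal.{0}} (hμ : ℵ₀ ≤ μ) {X : Type}
    (hX : #X ≤ Order.succ μ) :
    ∃ (Y : Type) (_ : LinearOrder Y) (ρ : X → Y) (h : Y → X → μ.out),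
      ∀ m x x', ρ x ≤ m → ρ x' ≤ m → h m x = h m x' → x = x' := by
  have hX' : #X ≤ #(Order.succ μ).ord.ToType := by rwa [mk_ord_toType]
  obtain ⟨ρ⟩ := hX'
  have hne : Nonempty μ.out := by
    rw [← mk_ne_zero_iff, mk_out]
    exact (aleph0_pos.trans_le hμ).ne'
  have key (m : (Order.succ μ).ord.ToType) :
      ∃ h : X → μ.out, Set.InjOn h {x | ρ x ≤ m} := by
    have h1 : #(Set.Iic m) ≤ #μ.out := by
      rw [mk_out, ← Order.lt_succ_iff, ← Set.Iio_insert]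
      refine (mk_insert_le).trans_lt ?_
      have h2 := mk_Iio_lt m (by rw [mk_ord_toType, Ordinal.type_toType])
      rw [mk_ord_toType] at h2
      refine add_lt_of_lt (hμ.trans (Order.le_succ μ)) h2 ?_
      exact one_lt_aleph0.trans_le (hμ.trans (Order.le_succ μ))
    obtain ⟨j⟩ := h1
    classical
    refine ⟨fun x => if hx : ρ x ≤ m then j ⟨ρ x, hx⟩ else Classical.arbitrary _, ?_⟩
    intro x hx x' hx' h
    rw [Set.mem_ofPred_eq] at hx hx'
    simp only [hx, hx', dite_true] at h
    exact ρ.injective (congrArg Subtype.val (j.injective h))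
  choose h hh using key
  exact ⟨_, inferInstance, ρ, h, fun m x x' hx hx' he => hh m hx hx' he⟩

/-- Tuples from a set of size `κ⁺ᴰ` can be colored with `κ` colors so that tuples of a given color
are determined by `D` of their coordinates. -/
lemma exists_coloring {κ : Cardinal.{0}} (hκ : ℵ₀ ≤ κ) (D d : ℕ) (X : Type)
    (hX : #X ≤ cardSucc κ D) :
    ∃ (C : Type) (c : (Fin d → X) → C) (I : C → Finset (Fin d)), #C ≤ κ ∧ (∀ z, (I z).card ≤ D) ∧
      ∀ t t', c t = c t' → (∀ i ∈ I (c t), t i = t' i) → t = t' := by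
  induction D generalizing X with
  | zero =>
    refine ⟨Fin d → X, id, fun _ => ∅, ?_, by simp, fun t t' h _ => h⟩
    rw [mk_pi, prod_const, lift_id, lift_id, mk_fin]
    exact (power_le_power_right hX).trans (power_nat_le hκ)
  | succ D ih =>
    rw [cardSucc_succ] at hX
    obtain ⟨Y, _, ρ, h, hh⟩ :=
      exists_initial_segment_injections (hκ.trans (le_cardSucc κ D)) hX
    obtain ⟨C, c, I, hC, hI, hc⟩ := ih (cardSucc κ D).out (mk_out _).le
    rcases d.eq_zero_or_pos with rfl | hd
    · exact ⟨Unit, fun _ => (), fun _ => ∅, by simpa using one_le_aleph0.trans hκ, by simp,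
        fun t t' _ _ => Subsingleton.elim _ _⟩
    have : Nonempty (Fin d) := ⟨⟨0, hd⟩⟩
    choose i hi using fun t : Fin d → X => Finite.exists_max (ρ ∘ t)
    refine ⟨Fin d × C, fun t => (i t, c (h (ρ (t (i t))) ∘ t)), fun z => insert z.1 (I z.2), ?_,
      fun z => (Finset.card_insert_le _ _).trans (Nat.succ_le_succ (hI _)), fun t t' he hag => ?_⟩
    · rw [mk_prod, lift_id, lift_id]
      refine mul_le_of_le hκ ?_ hC
      exact (mk_le_aleph0).trans hκ
    · obtain ⟨h1, h2⟩ := Prod.mk.inj he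
      have h3 : t (i t) = t' (i t) := hag _ (Finset.mem_insert_self _ _)
      rw [← h1, ← h3] at h2
      have h4 := hc _ _ h2 fun j hj =>
        congrArg (h (ρ (t (i t)))) (hag j (Finset.mem_insert_of_mem hj))
      funext j
      refine hh (ρ (t (i t))) _ _ (hi t j) ?_ (congrFun h4 j)
      rw [h3, h1]
      exact hi t' j

/-- Finitely many tuples are separated by fewer coordinates than there are tuples. -/
lemma exists_separating_finset {d : ℕ} {X : Type} (S : Finset (Fin d → X)) (hS : S.Nonempty) :
    ∃ I : Finset (Fin d), I.card + 1 ≤ S.card ∧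
      ∀ s ∈ S, ∀ s' ∈ S, (∀ i ∈ I, s i = s' i) → s = s' := by
  classical
  induction hS using Finset.Nonempty.cons_induction with
  | singleton a => exact ⟨∅, by simp, by simp⟩
  | cons a S ha hS ih =>
    obtain ⟨I, hI, hsep⟩ := ih
    by_cases h : ∃ s ∈ S, ∀ i ∈ I, s i = a i
    · obtain ⟨s, hs, hsa⟩ := h
      have hne : s ≠ a := fun h => ha (h ▸ hs)
      obtain ⟨i₀, hi₀⟩ := Function.ne_iff.1 hne
      have key : ∀ s' ∈ S, (∀ i ∈ insert i₀ I, s' i = a i) → False := fun s' hs' h => by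
        have h1 := hsep s hs s' hs' fun i hi =>
          (hsa i hi).trans (h i (Finset.mem_insert_of_mem hi)).symm
        exact hi₀ (h1 ▸ h i₀ (Finset.mem_insert_self _ _))
      refine ⟨insert i₀ I, ?_, ?_⟩
      · rw [Finset.card_cons]
        exact Nat.succ_le_succ ((Finset.card_insert_le _ _).trans hI)
      · intro s₁ h₁ s₂ h₂ h
        rcases Finset.mem_cons.1 h₁ with h₁ | h₁ <;> rcases Finset.mem_cons.1 h₂ with h₂ | h₂
        · exact h₁.trans h₂.symm
        · exact (key s₂ h₂ fun i hi => h₁ ▸ (h i hi).symm).elim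
        · exact (key s₁ h₁ fun i hi => h₂ ▸ h i hi).elim
        · exact hsep s₁ h₁ s₂ h₂ fun i hi => h i (Finset.mem_insert_of_mem hi)
    · refine ⟨I, hI.trans (Finset.card_le_card (Finset.subset_cons ha)), ?_⟩
      intro s₁ h₁ s₂ h₂ h'
      rcases Finset.mem_cons.1 h₁ with h₁ | h₁ <;> rcases Finset.mem_cons.1 h₂ with h₂ | h₂
      · exact h₁.trans h₂.symm
      · exact (h ⟨s₂, h₂, fun i hi => h₁ ▸ (h' i hi).symm⟩).elim
      · exact (h ⟨s₁, h₁, fun i hi => h₂ ▸ h' i hi⟩).elim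
      · exact hsep s₁ h₁ s₂ h₂ h'

/-- There is a coloring of tuples with `κ` colors such that any `k` tuples of the same color are
separated by at most `k - 1` coordinates, and by no more than the cardinality of `X` requires. -/
lemma exists_separating_coloring {κ : Cardinal.{0}} (hκ : ℵ₀ ≤ κ) (k d : ℕ) [NeZero k] (X : Type) :
    ∃ (C : Type) (c : (Fin d → X) → C), #C ≤ κ ∧ ∀ t : Fin k → Fin d → X, Function.Injective t →
      (∀ j l, c (t j) = c (t l)) → ∃ I : Finset (Fin d), I.card ≤ k - 1 ∧
        (I.card = 0 ∨ cardSucc κ I.card ≤ #X) ∧ ∀ j l, (∀ i ∈ I, t j i = t l i) → j = l := by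
  classical
  by_cases h : ∃ D, D ≤ k - 1 ∧ #X ≤ cardSucc κ D
  · obtain ⟨hDk, hD⟩ := Nat.find_spec h
    obtain ⟨C, c, I, hC, hI, hc⟩ := exists_coloring hκ (Nat.find h) d X hD
    refine ⟨C, c, hC, fun t ht hmono => ⟨I (c (t 0)), (hI _).trans hDk, ?_, fun j l hjl => ?_⟩⟩
    · rcases Nat.eq_zero_or_eq_succ_pred (Nat.find h) with h0 | h1
      · exact Or.inl (Nat.le_zero.1 (h0 ▸ hI _))
      · refine Or.inr ((cardSucc_mono κ (hI _)).trans ?_)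
        rw [h1, Nat.succ_eq_add_one, cardSucc_succ]
        refine Order.succ_le_of_lt (lt_of_not_ge fun hle => ?_)
        exact Nat.find_min h (m := (Nat.find h).pred) (by omega) ⟨by omega, hle⟩
    · exact ht (hc _ _ (hmono j l) fun i hi => hjl i (hmono j 0 ▸ hi))
  · refine ⟨Unit, fun _ => (), by simpa using one_le_aleph0.trans hκ, fun t ht _ => ?_⟩
    obtain ⟨I, hI, hsep⟩ := exists_separating_finset (Finset.univ.image t) (by simp)
    rw [Finset.card_image_of_injective _ ht, Finset.card_univ, Fintype.card_fin] at hI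
    have hI' : I.card ≤ k - 1 := Nat.le_sub_one_of_lt hI
    refine ⟨I, hI', Or.inr ?_, fun j l hjl => ht (hsep _ (by simp) _ (by simp) hjl)⟩
    exact (lt_of_not_ge fun hle => h ⟨_, hI', hle⟩).le

/-- A coloring of `κ⁺ᵉ`-many points in each of `e` directions with `κ` colors is constant on
arbitrarily large finite boxes. -/
lemma exists_mono_box {κ : Cardinal.{0}} (hκ : ℵ₀ ≤ κ) (e k : ℕ) (X : Type)
    (hX : cardSucc κ e ≤ #X) {C : Type} (hC : #C ≤ κ) (c : (Fin e → X) → C) :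
    ∃ A : Fin e → Fin k → X, (∀ i, Function.Injective (A i)) ∧
      ∃ z, ∀ s : Fin e → Fin k, c (fun i => A i (s i)) = z := by
  induction e generalizing X with
  | zero =>
    exact ⟨fun i => i.elim0, fun i => i.elim0, c fun i => i.elim0,
      fun s => congrArg c (Subsingleton.elim _ _)⟩
  | succ e ih =>
    rw [cardSucc_succ] at hX
    obtain ⟨X', hX'⟩ := le_mk_iff_exists_set.1 ((Order.le_succ _).trans hX)
    choose A hA z hz using fun x => ih X' hX'.ge
      fun t => c (Fin.cons (α := fun _ => X) x fun i => (t i : X))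
    have hμ : ℵ₀ ≤ cardSucc κ e := hκ.trans (le_cardSucc κ e)
    have hX₀ : Infinite X := infinite_iff.2 (hμ.trans ((Order.le_succ _).trans hX))
    have hcard : #((Fin e → Fin k → X') × C) < #X := by
      refine lt_of_le_of_lt ?_ (Order.succ_le_iff.1 hX)
      have h1 : #(Fin e → Fin k → X') ≤ cardSucc κ e := by
        rw [← mk_congr (Equiv.curry _ _ _), ← power_def, hX',
          show #(Fin e × Fin k) = ((e * k : ℕ) : Cardinal) by simp]
        exact power_nat_le hμ
      rw [mk_prod, lift_id, lift_id]
      exact mul_le_of_le hμ h1 (hC.trans (le_cardSucc κ e))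
    obtain ⟨⟨A', z'⟩, hfib⟩ := exists_infinite_fiber (fun x => (A x, z x)) hcard
    let φ := (Fin.valEmbedding (n := k)).trans
      (Infinite.natEmbedding ((fun x => (A x, z x)) ⁻¹' {(A', z')}))
    have hφ (j : Fin k) : A (φ j) = A' ∧ z (φ j) = z' := Prod.mk.inj (φ j).2
    refine ⟨Fin.cons (α := fun _ => Fin k → X) (fun j => φ j) fun i j => A' i j, ?_, z', ?_⟩
    · intro i
      refine Fin.cases ?_ (fun i => ?_) i
      · exact Subtype.val_injective.comp φ.injective
      · intro j l hjl
        have := hA (φ j) i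
        rw [(hφ j).1] at this
        exact this (Subtype.ext hjl)
    · intro s
      refine (congrArg c ?_).trans ((hz (φ (s 0)) (Fin.tail s)).trans (hφ (s 0)).2)
      funext i
      refine Fin.cases rfl (fun i => ?_) i
      simp [(hφ (s 0)).1, Fin.tail]

lemma ncard_patternTemplate {k e : ℕ} {σ : Fin k → Fin e → Fin k} (hσ : Function.Injective σ) :
    (patternTemplate σ).ncard = k := by
  have : Function.Injective fun j i => ((σ j i : ℕ) : ℝ) := fun j l h => hσ <| by
    funext i
    have := congrFun h i
    simpa [Fin.val_inj] using this
  rw [patternTemplate, ← Set.image_univ, Set.ncard_image_of_injective _ this, Set.ncard_univ,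
    Nat.card_fin]

lemma not_hgColorable_templateEdges {κ : Cardinal.{0}} (hκ : ℵ₀ ≤ κ) {k e : ℕ} [NeZero k]
    (he : cardSucc κ e ≤ 𝔠) {σ : Fin k → Fin e → Fin k} (hσ : Function.Injective σ) :
    ¬ HGColorable (templateEdges k (B := fun _ => ℝ) (patternTemplate σ)) κ := by
  rintro ⟨C, c, hC, hc⟩
  obtain ⟨A, hA, z, hz⟩ := exists_mono_box hκ e k ℝ (by rwa [mk_real]) hC c
  have hinj : Function.Injective fun j i => A i (σ j i) := fun j l h =>
    hσ (funext fun i => hA i (congrFun h i))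
  have hcast : Function.Injective fun b : Fin k => ((b : ℕ) : ℝ) :=
    Nat.cast_injective.comp Fin.val_injective
  let f : (Fin e → ℝ) → Fin e → ℝ := fun v i =>
    A i (Function.invFun (fun b : Fin k => ((b : ℕ) : ℝ)) (v i))
  have hf (j) : f (fun i => ((σ j i : ℕ) : ℝ)) = fun i => A i (σ j i) := by
    funext i
    exact congrArg (A i) (Function.leftInverse_invFun hcast _)
  obtain ⟨_, ⟨j, rfl⟩, _, ⟨l, rfl⟩, hjl⟩ := hc (Set.range fun j i => A i (σ j i)) <| by
    refine ⟨?_, f, ?_, ?_, ?_⟩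
    · rw [← Set.image_univ, Set.ncard_image_of_injective _ hinj, Set.ncard_univ, Nat.card_fin]
    · rintro _ ⟨j, rfl⟩
      exact ⟨j, (hf j).symm⟩
    · rintro _ ⟨j, rfl⟩
      exact ⟨_, ⟨j, rfl⟩, hf j⟩
    · intro x _ y _ i hxy
      simp only [f, hxy]
  exact hjl ((hz _).trans (hz _).symm)

lemma HGColorable.of_hgContains {V₁ V₂ : Type} {E₁ : Set (Set V₁)} {E₂ : Set (Set V₂)}
    {κ : Cardinal.{0}} (h : HGColorable E₂ κ) (hE : HGContains E₁ E₂) : HGColorable E₁ κ := by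
  obtain ⟨C, c, hC, hc⟩ := h
  obtain ⟨f, -, hf⟩ := hE
  refine ⟨C, c ∘ f, hC, fun e he => ?_⟩
  obtain ⟨_, ⟨x, hx, rfl⟩, _, ⟨y, hy, rfl⟩, hxy⟩ := hc _ (hf e he)
  exact ⟨x, hx, y, hy, hxy⟩

lemma chrNum_le_iff {V : Type} {E : Set (Set V)} (hE : ∀ e ∈ E, e.Nontrivial)
    {κ : Cardinal.{0}} : chrNum E ≤ κ ↔ HGColorable E κ := by
  refine ⟨fun h => ?_, fun h => csInf_le' h⟩
  have hne : {κ : Cardinal | HGColorable E κ}.Nonempty :=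
    ⟨#V, V, id, le_rfl, fun e he => hE e he⟩
  obtain ⟨C, c, hC, hc⟩ := csInf_mem hne
  exact ⟨C, c, hC.trans h, hc⟩

lemma nontrivial_of_mem_zeroEdges {n k : ℕ} (hk : 2 ≤ k) (p : MvPolynomial (Fin k × Fin n) ℝ) :
    ∀ e ∈ zeroEdges p, e.Nontrivial := by
  rintro _ ⟨a, ha, rfl, -⟩
  have : Nontrivial (Fin k) := Fin.nontrivial_iff_two_le.2 hk
  obtain ⟨j, l, hjl⟩ := exists_pair_ne (Fin k)
  exact ⟨a j, ⟨j, rfl⟩, a l, ⟨l, rfl⟩, ha.ne hjl⟩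

/-- A real polynomial has coefficients in a countable field. -/
lemma exists_countable_coeff_field {σ : Type} (p : MvPolynomial σ ℝ) :
    ∃ (K : Subfield ℝ) (q : MvPolynomial σ K), Countable K ∧ q.map (algebraMap K ℝ) = p := by
  let K := Subfield.closure (p.coeffs : Set ℝ)
  have hp : p ∈ Set.range (MvPolynomial.map (algebraMap K ℝ)) := by
    rw [MvPolynomial.mem_range_map_iff_coeffs_subset]
    intro r hr
    exact ⟨⟨r, Subfield.subset_closure hr⟩, rfl⟩
  obtain ⟨q, hq⟩ := hp
  refine ⟨K, q, ?_, hq⟩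
  rw [← mk_le_aleph0_iff]
  refine (Subfield.cardinalMk_closure_le_max _).trans (max_le ?_ le_rfl)
  exact mk_le_aleph0

/-- The data describing a tuple of algebraic analytic functions on a rational box of injective
tuples. -/
def AlgebraicGerm (K : Type) [Field K] [Algebra K ℝ] (n : ℕ) : Type :=
  Σ (d : ℕ) (β : Fin d → ℚ × ℚ),
    Fin n → {g : analyticRing (ratBox β) // IsAlgebraic (MvPolynomial (Fin d) K) g}

instance {K : Type} [Field K] [Algebra K ℝ] [Countable K] {n : ℕ} :
    Countable (AlgebraicGerm K n) := by
  have (d : ℕ) (β : Fin d → ℚ × ℚ) :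
      Countable {g : analyticRing (ratBox β) // IsAlgebraic (MvPolynomial (Fin d) K) g} :=
    (countable_isAlgebraic (isOpen_ratBox β) (convex_ratBox β).isPreconnected).to_subtype
  unfold AlgebraicGerm
  infer_instance

lemma hgColorable_of_not_hgContains {κ : Cardinal.{0}} (hκ : ℵ₀ ≤ κ) {n k : ℕ} (hk : 2 ≤ k)
    (p : MvPolynomial (Fin k × Fin n) ℝ)
    (h : ∀ e, 1 ≤ e → e ≤ k - 1 → cardSucc κ e ≤ 𝔠 → ∀ σ : Fin k → Fin e → Fin k,
      Function.Injective σ →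
        ¬ HGContains (templateEdges k (B := fun _ => ℝ) (patternTemplate σ)) (zeroEdges p)) :
    HGColorable (zeroEdges p) κ := by
  classical
  have : NeZero k := ⟨by omega⟩
  obtain ⟨K, p, hK, rfl⟩ := exists_countable_coeff_field p
  obtain ⟨τ, hτ, hτalg, hτI⟩ := exists_spread_basis K
  have hrep (x : Fin n → ℝ) : ∃ (z : AlgebraicGerm K n) (t : Fin z.1 → ℝ × ℚ × ℚ),
      (∀ u ∈ ratBox z.2.1, Function.Injective u) ∧ τ ∘ t ∈ ratBox z.2.1 ∧
        ∀ l, ev (z.2.2 l).1 (τ ∘ t) = x l := by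
    obtain ⟨d, β, g, t, hg, ht, hβ, hx⟩ := exists_representation hτ hτalg x
    exact ⟨⟨d, β, fun l => ⟨g l, hg l⟩⟩, t, hβ, ht, hx⟩
  choose z t hzβ ht hx using hrep
  choose J hJ hJmin using fun z : AlgebraicGerm K n =>
    exists_minimal_determines fun l => (z.2.2 l).1
  choose C c hC hc using fun z : AlgebraicGerm K n =>
    exists_separating_coloring hκ k z.1 (ℝ × ℚ × ℚ)
  let mask (z : AlgebraicGerm K n) (t : Fin z.1 → ℝ × ℚ × ℚ) : Fin z.1 → ℝ × ℚ × ℚ :=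
    fun i => if i ∈ J z then t i else 0
  let φ (x : Fin n → ℝ) : Σ z, C z := ⟨z x, c (z x) (mask (z x) (t x))⟩
  have hφ (x) (z₀) (w) (h : φ x = ⟨z₀, w⟩) : ∃ t : Fin z₀.1 → ℝ × ℚ × ℚ,
      (∀ u ∈ ratBox z₀.2.1, Function.Injective u) ∧ τ ∘ t ∈ ratBox z₀.2.1 ∧
        (∀ l, ev (z₀.2.2 l).1 (τ ∘ t) = x l) ∧ c z₀ (mask z₀ t) = w := by
    cases h
    exact ⟨t x, hzβ x, ht x, hx x, rfl⟩
  refine ⟨Σ z, C z, φ, ?_, ?_⟩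
  · rw [mk_sigma]
    refine (sum_le_sum _ (fun _ => κ) hC).trans ?_
    rw [sum_const']
    exact mul_le_of_le hκ (mk_le_aleph0.trans hκ) le_rfl
  · rintro _ ⟨a, ha, rfl, h0⟩
    by_contra! hmono
    have hmono' (j : Fin k) : φ (a j) = φ (a 0) := hmono _ ⟨j, rfl⟩ _ ⟨0, rfl⟩
    obtain ⟨⟨z₀, w₀⟩, hz₀⟩ : ∃ y, φ (a 0) = y := ⟨_, rfl⟩
    simp only [hz₀] at hmono'
    choose s hs hsB hsx hsw using fun j => hφ _ _ _ (hmono' j)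
    have hsinj : Function.Injective fun j => mask z₀ (s j) := fun j l hjl => ha <| by
      funext i
      rw [← hsx j, ← hsx l]
      refine hJ z₀ _ (hsB j) _ (hsB l) (fun m hm => ?_) i
      have := congrFun hjl m
      simp only [mask, hm, if_true] at this
      exact congrArg τ this
    obtain ⟨I, hIk, hIc, hI⟩ := hc z₀ _ hsinj fun j l => (hsw j).trans (hsw l).symm
    have hI' (j l) (hjl : ∀ i ∈ I ∩ J z₀, s j i = s l i) : j = l := hI j l fun i hi => by
      by_cases hiJ : i ∈ J z₀
      · simp only [mask, hiJ, if_true]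
        exact hjl i (Finset.mem_inter.2 ⟨hi, hiJ⟩)
      · simp only [mask, hiJ, if_false]
    have hpos : 1 ≤ (I ∩ J z₀).card := by
      rw [Nat.one_le_iff_ne_zero, Finset.card_ne_zero]
      by_contra hempty
      rw [Finset.not_nonempty_iff_eq_empty] at hempty
      have := hI' ⟨0, by omega⟩ ⟨1, by omega⟩ (by simp [hempty])
      simp at this
    have hle : (I ∩ J z₀).card ≤ I.card := Finset.card_le_card Finset.inter_subset_left
    obtain ⟨σ, hσ, hcont⟩ := hgContains_of_edge hτ hτI (hs 0) (fun l => (z₀.2.2 l).2)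
      (hJmin z₀) p s hsB (by
        rw [MvPolynomial.eval_map, ← MvPolynomial.aeval_def] at h0
        simpa only [hsx] using h0) Finset.inter_subset_right hI'
    refine h _ hpos (hle.trans hIk) ?_ σ hσ hcont
    rcases hIc with hIc | hIc
    · omega
    · refine (cardSucc_mono κ hle).trans (hIc.trans ?_)
      simp [mk_real]

/-- Corollary 2.4: for each `k ≥ 2` and infinite `κ` there is
a finite list of forbidden template hypergraphs `L(ℝ^{e_j}, P_j)` (with
`1 ≤ e_j ≤ k-1`) characterizing the algebraic `k`-hypergraphs of chromatic
number at most `κ`. -/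
theorem statement3 (k : ℕ) (hk : 2 ≤ k) (κ : Cardinal) (hκ : Cardinal.aleph0 ≤ κ) :
    ∃ (m : ℕ) (e : Fin m → ℕ) (P : ∀ j : Fin m, Set (Fin (e j) → ℝ)),
      (∀ j, 1 ≤ e j ∧ e j ≤ k - 1 ∧ (P j).ncard = k) ∧
      ∀ n : ℕ, 1 ≤ n → ∀ p : MvPolynomial (Fin k × Fin n) ℝ,
        (chrNum (zeroEdges p) ≤ κ ↔
          ∀ j : Fin m,
            ¬ HGContains (templateEdges k (B := fun _ : Fin (e j) => ℝ) (P j))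
                (zeroEdges p)) := by
  have : NeZero k := ⟨by omega⟩
  let T := {q : Σ e : Fin k, Fin k → Fin e → Fin k //
    1 ≤ (q.1 : ℕ) ∧ cardSucc κ q.1 ≤ 𝔠 ∧ Function.Injective q.2}
  let ψ : T ≃ Fin (Nat.card T) := Finite.equivFin T
  refine ⟨Nat.card T, fun j => ((ψ.symm j).1.1 : ℕ), fun j => patternTemplate (ψ.symm j).1.2,
    fun j => ⟨(ψ.symm j).2.1, Nat.le_sub_one_of_lt (ψ.symm j).1.1.2,
      ncard_patternTemplate (ψ.symm j).2.2.2⟩, fun n _ p => ?_⟩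
  rw [chrNum_le_iff (nontrivial_of_mem_zeroEdges hk p)]
  refine ⟨fun h j hj => not_hgColorable_templateEdges hκ (ψ.symm j).2.2.1 (ψ.symm j).2.2.2
    (h.of_hgContains hj), fun h => hgColorable_of_not_hgContains hκ hk p ?_⟩
  intro e he hek hec σ hσ hcont
  let q : T := ⟨⟨⟨e, by omega⟩, σ⟩, he, hec, hσ⟩
  have := h (ψ q)
  beta_reduce at this
  rw [ψ.symm_apply_apply] at this
  exact this hcont
end

section
/- Let n ≥ 1 and let D be a set of positive reals. Then the D-distance graph X_n(D) on ℝⁿ satisfies χ(X_n(D)) ≤ |D| + ℵ₀; that is, there is a function f from ℝⁿ to a set of cardinality at most |D| + ℵ₀ such that whenever x,y ∈ ℝⁿ and the Euclidean distance ‖x − y‖ ∈ D, then f(x) ≠ f(y). -/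
open Cardinal

open scoped Topology

/-- The real-valued functions on `U` that extend to a function analytic at every point of `U`. -/
def analyticSubalgebra {E : Type} [NormedAddCommGroup E] [NormedSpace ℝ E] (U : Set E) :
    Subalgebra ℝ (U → ℝ) where
  carrier := {f | ∃ g : E → ℝ, AnalyticOnNhd ℝ g U ∧ ∀ x : U, f x = g x}
  mul_mem' := by
    rintro _ _ ⟨g, hg, hfg⟩ ⟨g', hg', hfg'⟩
    exact ⟨g * g', hg.mul hg', fun x => by simp [hfg, hfg']⟩
  add_mem' := by
    rintro _ _ ⟨g, hg, hfg⟩ ⟨g', hg', hfg'⟩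
    exact ⟨g + g', hg.add hg', fun x => by simp [hfg, hfg']⟩
  algebraMap_mem' r := ⟨fun _ => r, analyticOnNhd_const, fun _ => rfl⟩

namespace analyticSubalgebra

theorem isDomain {E : Type} [NormedAddCommGroup E] [NormedSpace ℝ E] {U : Set E}
    (hU : IsPreconnected U) (hne : U.Nonempty) (ho : IsOpen U) :
    IsDomain (analyticSubalgebra U) := by
  have : Nonempty U := hne.to_subtype
  rw [isDomain_iff_noZeroDivisors_and_nontrivial]
  refine ⟨⟨fun {f f'} h => ?_⟩, inferInstance⟩
  obtain ⟨g, hg, hfg⟩ := f.2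
  obtain ⟨g', hg', hfg'⟩ := f'.2
  have hmul : ∀ x ∈ U, g x * g' x = 0 := fun x hx => by
    have := congrFun (congrArg Subtype.val h) ⟨x, hx⟩
    simpa [hfg, hfg'] using this
  by_contra! hne
  obtain ⟨x, hx⟩ : ∃ x, f.1 x ≠ 0 := by
    by_contra! h0
    exact hne.1 (Subtype.ext (funext h0))
  have hx' : g x ≠ 0 := hfg x ▸ hx
  refine hne.2 (Subtype.ext (funext fun y => ?_))
  rw [hfg']
  refine hg'.eqOn_zero_of_preconnected_of_eventuallyEq_zero hU x.2 ?_ y.2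
  filter_upwards [(hg x x.2).continuousAt.eventually_ne hx', ho.mem_nhds x.2] with z hz hzU
  exact (mul_eq_zero.mp (hmul z hzU)).resolve_left hz

/-- Evaluation of an analytic function at a point of its domain. -/
def eval {E : Type} [NormedAddCommGroup E] [NormedSpace ℝ E] {U : Set E} (x : U) :
    analyticSubalgebra U →ₐ[ℝ] ℝ :=
  (Pi.evalAlgHom ℝ (fun _ : U => ℝ) x).comp (analyticSubalgebra U).val

theorem eval_apply {E : Type} [NormedAddCommGroup E] [NormedSpace ℝ E] {U : Set E} (x : U)
    (f : analyticSubalgebra U) : eval x f = f.1 x := rfl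

/-- Pullback of analytic functions along a continuous linear map. -/
def comap {E F : Type} [NormedAddCommGroup E] [NormedSpace ℝ E] [NormedAddCommGroup F]
    [NormedSpace ℝ F] {U : Set E} {V : Set F} (L : E →L[ℝ] F) (h : Set.MapsTo L U V) :
    analyticSubalgebra V →ₐ[ℝ] analyticSubalgebra U where
  toFun f := ⟨fun x => f.1 ⟨L x, h x.2⟩, by
    obtain ⟨g, hg, hfg⟩ := f.2
    exact ⟨g ∘ L, fun x hx => (hg _ (h hx)).comp (L.analyticAt x), fun x => hfg _⟩⟩
  map_one' := rfl
  map_mul' _ _ := rfl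
  map_zero' := rfl
  map_add' _ _ := rfl
  commutes' _ := rfl

variable {ι : Type} [Fintype ι] {K : Subfield ℝ}

/-- The coordinate functions. -/
def coord (U : Set (ι → ℝ)) (i : ι) : analyticSubalgebra U :=
  ⟨fun x => x.1 i, fun x => x i,
    fun x _ => (ContinuousLinearMap.proj (R := ℝ) (φ := fun _ : ι => ℝ) i).analyticAt x,
    fun _ => rfl⟩

noncomputable instance mvPolynomialAlgebra (U : Set (ι → ℝ)) :
    Algebra (MvPolynomial ι K) (analyticSubalgebra U) :=
  (MvPolynomial.aeval (R := K) (coord U)).toRingHom.toAlgebra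

theorem eval_algebraMap {U : Set (ι → ℝ)} (x : U) (p : MvPolynomial ι K) :
    eval x (algebraMap (MvPolynomial ι K) (analyticSubalgebra U) p) =
      MvPolynomial.aeval x.1 p := by
  change ((eval x).restrictScalars K).comp (MvPolynomial.aeval (R := K) (coord U)) p = _
  congr 1
  ext i
  simp [eval_apply, coord]

/-- An algebraic analytic function vanishing at a generic point vanishes identically. -/
theorem eq_zero_of_eval_eq_zero {U : Set (ι → ℝ)} [IsDomain (analyticSubalgebra U)] {x : U}
    (hx : AlgebraicIndependent K x.1) {f : analyticSubalgebra U}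
    (hf : IsAlgebraic (MvPolynomial ι K) f) (h0 : eval x f = 0) : f = 0 := by
  by_contra hne
  obtain ⟨p, hp, g, hg⟩ := hf.exists_nonzero_dvd (mem_nonZeroDivisors_of_ne_zero hne)
  apply hp
  apply hx
  rw [← eval_algebraMap x p, hg, map_mul, h0, zero_mul, map_zero]

/-- Reindexing of coordinates as a continuous linear map. -/
def reindex {κ : Type} (t : κ → ι) : (ι → ℝ) →L[ℝ] (κ → ℝ) :=
  ContinuousLinearMap.pi fun k => ContinuousLinearMap.proj (t k)

theorem isAlgebraic_comap {κ : Type} [Fintype κ] {U : Set (ι → ℝ)} {V : Set (κ → ℝ)} {t : κ → ι}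
    (ht : Function.Injective t) (h : Set.MapsTo (reindex t) U V) {f : analyticSubalgebra V}
    (hf : IsAlgebraic (MvPolynomial κ K) f) :
    IsAlgebraic (MvPolynomial ι K) (comap (reindex t) h f) := by
  refine hf.ringHom_of_comp_eq (MvPolynomial.rename (R := K) t).toRingHom
    (comap (reindex t) h).toRingHom (MvPolynomial.rename_injective t ht) ?_
  refine RingHom.ext fun p => Subtype.ext (funext fun x => ?_)
  change eval x (algebraMap _ _ (MvPolynomial.rename t p)) = eval ⟨reindex t x.1, h x.2⟩
    (algebraMap (MvPolynomial κ K) (analyticSubalgebra V) p)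
  rw [eval_algebraMap, eval_algebraMap, MvPolynomial.aeval_rename]
  rfl

end analyticSubalgebra

/-- A sup-norm ball with rational center and radius whose coordinate projections are pairwise
disjoint and which contains a point with algebraically independent coordinates over `K`. -/
structure GenericBall (K : Subfield ℝ) where
  dim : ℕ
  center : Fin dim → ℚ
  radius : ℚ
  separated : ∀ i j, i ≠ j → 2 * (radius : ℝ) ≤ |(center i : ℝ) - center j|
  exists_generic : ∃ t : Fin dim → ℝ, AlgebraicIndependent K t ∧
    t ∈ Metric.ball (fun i => (center i : ℝ)) radius

namespace GenericBall

variable {K : Subfield ℝ}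

/-- The underlying set of a generic ball. -/
def carrier (b : GenericBall K) : Set (Fin b.dim → ℝ) :=
  Metric.ball (fun i => (b.center i : ℝ)) b.radius

theorem isPreconnected_carrier (b : GenericBall K) : IsPreconnected b.carrier :=
  (convex_ball _ _).isPreconnected

theorem isDomain (b : GenericBall K) : IsDomain (analyticSubalgebra b.carrier) :=
  let ⟨t, ht⟩ := b.exists_generic
  analyticSubalgebra.isDomain b.isPreconnected_carrier ⟨t, ht.2⟩ Metric.isOpen_ball

instance : Countable (GenericBall K) := by
  refine Function.Injective.countable
    (f := fun b : GenericBall K => (⟨b.dim, b.center, b.radius⟩ : Σ m, (_ : Fin m → ℚ) × ℚ)) ?_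
  rintro ⟨m, q, r, _, _⟩ ⟨m', q', r', _, _⟩ h
  simp only [Sigma.mk.injEq] at h
  obtain ⟨rfl, h⟩ := h
  simp only [heq_eq_eq, Sigma.mk.injEq] at h
  obtain ⟨rfl, rfl⟩ := h
  rfl

theorem eq_of_apply_eq (b : GenericBall K) {t s : Fin b.dim → ℝ} (ht : t ∈ b.carrier)
    (hs : s ∈ b.carrier) {i j : Fin b.dim} (h : t i = s j) : i = j := by
  by_contra hij
  have h1 := b.separated i j hij
  have h2 := (dist_le_pi_dist t _ i).trans_lt (Metric.mem_ball.mp ht)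
  have h3 := (dist_le_pi_dist s _ j).trans_lt (Metric.mem_ball.mp hs)
  rw [Real.dist_eq] at h2 h3
  rw [h] at h2
  have := abs_sub_le (b.center i : ℝ) (s j) (b.center j)
  rw [abs_sub_comm _ (s j)] at this
  linarith

theorem injective_algebraMap (b : GenericBall K) :
    Function.Injective
      (algebraMap (MvPolynomial (Fin b.dim) K) (analyticSubalgebra b.carrier)) := by
  obtain ⟨t, ht, htb⟩ := b.exists_generic
  refine fun p p' h => ht ?_
  have := congrArg (analyticSubalgebra.eval (U := b.carrier) ⟨t, htb⟩) h
  rwa [analyticSubalgebra.eval_algebraMap, analyticSubalgebra.eval_algebraMap] at this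

/-- The analytic functions on a generic ball that are algebraic over the polynomials over `K`. -/
abbrev AlgFun (b : GenericBall K) : Type :=
  {f : analyticSubalgebra b.carrier // IsAlgebraic (MvPolynomial (Fin b.dim) K) f}

theorem mk_algFun_le (b : GenericBall K) : #b.AlgFun ≤ max #K ℵ₀ := by
  have := b.isDomain
  have : Module.IsTorsionFree (MvPolynomial (Fin b.dim) K) (analyticSubalgebra b.carrier) :=
    Module.isTorsionFree_iff_algebraMap_injective.mpr b.injective_algebraMap
  refine (Algebraic.cardinalMk_le_max _ _).trans
    (max_le (MvPolynomial.cardinalMk_le_max.trans ?_) (le_max_right _ _))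
  exact max_le (max_le (le_max_left _ _) (Cardinal.mk_le_aleph0.trans (le_max_right _ _)))
    (le_max_right _ _)

end GenericBall

/-- The colors used for `ℝⁿ`. -/
abbrev DistanceColor (K : Subfield ℝ) (n : ℕ) : Type :=
  Σ b : GenericBall K, Fin n → b.AlgFun

theorem mk_distanceColor_le (K : Subfield ℝ) (n : ℕ) : #(DistanceColor K n) ≤ max #K ℵ₀ := by
  rw [Cardinal.mk_sigma]
  refine (Cardinal.sum_le_mk_mul_iSup _).trans ?_
  refine (Cardinal.mul_le_max _ _).trans (max_le (max_le ?_ ?_) (le_max_right _ _))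
  · exact Cardinal.mk_le_aleph0.trans (le_max_right _ _)
  · refine ciSup_le' fun b => ?_
    rw [← Cardinal.power_def, Cardinal.mk_fin, Cardinal.power_natCast]
    refine (Cardinal.power_nat_le_max).trans ?_
    exact max_le b.mk_algFun_le (le_max_right _ _)

/-- The color `c` is admissible for `x` if `x` is the value of the functions in `c` at a point
whose coordinates are distinct elements of `T`. -/
def DistanceColor.Admissible {K : Subfield ℝ} {n : ℕ} (T : Set ℝ) (c : DistanceColor K n)
    (x : Fin n → ℝ) : Prop :=
  ∃ t : Fin c.1.dim → T, Function.Injective t ∧ ∃ ht : (fun i => (t i : ℝ)) ∈ c.1.carrier,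
    ∀ i, (c.2 i).1.1 ⟨_, ht⟩ = x i

open analyticSubalgebra in
theorem DistanceColor.Admissible.sum_sq_ne {K : Subfield ℝ} {n : ℕ} {T : Set ℝ}
    (hT : AlgebraicIndependent K ((↑) : T → ℝ)) {c : DistanceColor K n} {x y : Fin n → ℝ}
    (hx : c.Admissible T x) (hy : c.Admissible T y) {d : K} (hd : d ≠ 0) :
    ∑ i, (x i - y i) ^ 2 ≠ (d : ℝ) := by
  classical
  obtain ⟨b, φ⟩ := c
  obtain ⟨t, htinj, htb, htx⟩ := hx
  obtain ⟨s, hsinj, hsb, hsy⟩ := hy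
  dsimp only at t s htinj hsinj htb hsb htx hsy
  intro hdist
  let S : Finset T := Finset.univ.image t ∪ Finset.univ.image s
  let t' : Fin b.dim → S := fun i => ⟨t i, by simp [S]⟩
  let s' : Fin b.dim → S := fun i => ⟨s i, by simp [S]⟩
  have ht' : Function.Injective t' := fun i j h => htinj (congrArg Subtype.val h)
  have hs' : Function.Injective s' := fun i j h => hsinj (congrArg Subtype.val h)
  let U : Set (S → ℝ) := reindex t' ⁻¹' b.carrier ∩ reindex s' ⁻¹' b.carrier
  let p : S → ℝ := fun v => (v : T)
  have hpU : p ∈ U := ⟨htb, hsb⟩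
  have hp : AlgebraicIndependent K p := hT.comp _ Subtype.val_injective
  have hconv : Convex ℝ U :=
    ((convex_ball _ _).is_linear_preimage (reindex t').isBoundedLinearMap.toIsLinearMap).inter
      ((convex_ball _ _).is_linear_preimage (reindex s').isBoundedLinearMap.toIsLinearMap)
  have hopen : IsOpen U := (Metric.isOpen_ball.preimage (reindex t').continuous).inter
    (Metric.isOpen_ball.preimage (reindex s').continuous)
  have := analyticSubalgebra.isDomain hconv.isPreconnected ⟨p, hpU⟩ hopen
  have htU : Set.MapsTo (reindex t') U b.carrier := fun _ h => h.1
  have hsU : Set.MapsTo (reindex s') U b.carrier := fun _ h => h.2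
  let G : analyticSubalgebra U :=
    ∑ i, (comap (reindex t') htU (φ i).1 - comap (reindex s') hsU (φ i).1) ^ 2 -
      algebraMap (MvPolynomial S K) _ (MvPolynomial.C d)
  have hGalg : IsAlgebraic (MvPolynomial S K) G := by
    refine IsAlgebraic.sub (sum_mem (S := Subalgebra.algebraicClosure (MvPolynomial S K) _)
      fun i _ => ?_) (isAlgebraic_algebraMap _)
    exact ((isAlgebraic_comap ht' htU (φ i).2).sub (isAlgebraic_comap hs' hsU (φ i).2)).pow 2
  have hG (u : U) : eval u G = ∑ i, ((φ i).1.1 ⟨_, htU u.2⟩ - (φ i).1.1 ⟨_, hsU u.2⟩) ^ 2 - d := by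
    simp only [G, map_sub, map_sum, map_pow, eval_algebraMap, MvPolynomial.aeval_C]
    rfl
  have hG0 : G = 0 := by
    refine eq_zero_of_eval_eq_zero (x := ⟨p, hpU⟩) hp hGalg ?_
    rw [hG, ← hdist, sub_eq_zero]
    refine Finset.sum_congr rfl fun i _ => ?_
    rw [← htx, ← hsy]
    rfl
  let q : S → ℝ := fun v => if h : ∃ i, s' i = v then t h.choose else (v : T)
  have hqs (i) : q (s' i) = t i := by
    have h : ∃ j, s' j = s' i := ⟨i, rfl⟩
    simp only [q, dif_pos h]
    rw [hs' h.choose_spec]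
  have hqt (i) : q (t' i) = t i := by
    by_cases h : ∃ j, s' j = t' i
    · obtain ⟨j, hj⟩ := h
      have : j = i := b.eq_of_apply_eq hsb htb (congrArg (fun v : S => ((v : T) : ℝ)) hj)
      rw [← hj, hqs, this]
    · simp only [q, dif_neg h, t']
  have e1 : reindex t' q = fun i => (t i : ℝ) := funext hqt
  have e2 : reindex s' q = fun i => (t i : ℝ) := funext hqs
  have hqU : q ∈ U := ⟨by rw [Set.mem_preimage, e1]; exact htb,
    by rw [Set.mem_preimage, e2]; exact htb⟩
  have := hG ⟨q, hqU⟩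
  simp only [hG0, map_zero, e1, e2, sub_self] at this
  apply hd
  simpa using this

theorem IsAlgebraic.exists_aeval_derivative_ne_zero {A L : Type} [CommRing A] [IsDomain A]
    [CharZero A] [CommRing L] [Algebra A L] (hinj : Function.Injective (algebraMap A L)) {a : L}
    (ha : IsAlgebraic A a) :
    ∃ P : Polynomial A, Polynomial.aeval a P = 0 ∧ Polynomial.aeval a P.derivative ≠ 0 := by
  obtain ⟨P, ⟨hP0, hPa⟩, hmin⟩ := WellFounded.has_min (measure Polynomial.natDegree).wf
    {P : Polynomial A | P ≠ 0 ∧ Polynomial.aeval a P = 0} ha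
  refine ⟨P, hPa, fun hder => ?_⟩
  have hdeg : P.natDegree ≠ 0 := fun h => by
    rw [Polynomial.eq_C_of_natDegree_eq_zero h] at hPa hP0
    rw [Polynomial.aeval_C, map_eq_zero_iff _ hinj] at hPa
    exact hP0 (by rw [hPa, map_zero])
  refine hmin P.derivative ⟨fun h => ?_, hder⟩ (Polynomial.natDegree_derivative_lt hdeg)
  exact hdeg (Polynomial.derivative_eq_zero.mp h)

/-- The analytic implicit function theorem for a simple root of a polynomial with polynomial
coefficients. -/
theorem exists_analyticAt_root {ι : Type} [Fintype ι] {K : Subfield ℝ}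
    (P : Polynomial (MvPolynomial ι K)) (t : ι → ℝ) (a : ℝ)
    (h0 : P.eval₂ (MvPolynomial.aeval t).toRingHom a = 0)
    (h1 : P.derivative.eval₂ (MvPolynomial.aeval t).toRingHom a ≠ 0) :
    ∃ g : (ι → ℝ) → ℝ, AnalyticAt ℝ g t ∧ g t = a ∧
      ∀ᶠ u in 𝓝 t, P.eval₂ (MvPolynomial.aeval u).toRingHom (g u) = 0 := by
  let F : (ι → ℝ) × ℝ → ℝ := fun v => P.eval₂ (MvPolynomial.aeval v.1).toRingHom v.2
  have hF : AnalyticAt ℝ F (t, a) := by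
    simp only [F, Polynomial.eval₂_eq_sum, Polynomial.sum]
    refine Finset.analyticAt_fun_sum _ fun k _ => ?_
    refine AnalyticAt.mul ?_ (analyticAt_snd.pow k)
    refine AnalyticAt.aeval_mvPolynomial (fun i => ?_) _
    exact ((ContinuousLinearMap.proj (R := ℝ) (φ := fun _ : ι => ℝ) i).comp
      (ContinuousLinearMap.fst ℝ (ι → ℝ) ℝ)).analyticAt _
  have hcd : ContDiffAt ℝ ⊤ F (t, a) := hF.contDiffAt
  have hder : HasDerivAt (fun z => F (t, z))
      (P.derivative.eval₂ (MvPolynomial.aeval t).toRingHom a) a := by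
    have := (P.map (MvPolynomial.aeval t).toRingHom).hasDerivAt a
    simpa only [Polynomial.derivative_map, Polynomial.eval_map] using this
  have hpart : fderiv ℝ F (t, a) ∘L .inr ℝ (ι → ℝ) ℝ =
      ContinuousLinearMap.toSpanSingleton ℝ
        (P.derivative.eval₂ (MvPolynomial.aeval t).toRingHom a) := by
    have h2 := (hF.differentiableAt.hasFDerivAt).comp a
      (hasFDerivAt_prodMk_right (𝕜 := ℝ) t a)
    exact h2.unique hder.hasFDerivAt
  have hinv : (fderiv ℝ F (t, a) ∘L .inr ℝ (ι → ℝ) ℝ).IsInvertible := by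
    rw [hpart]
    exact ⟨ContinuousLinearEquiv.unitsEquivAut ℝ (Units.mk0 _ h1), by ext; simp⟩
  refine ⟨hcd.implicitFunction (by simp) hinv, ?_,
    hcd.implicitFunction_apply_self (by simp) hinv, ?_⟩
  · exact (hcd.contDiffAt_implicitFunction (by simp) hinv).analyticAt
  · filter_upwards [hcd.eventually_apply_implicitFunction (by simp) hinv] with u hu
    exact hu.trans h0

theorem GenericBall.exists_subset_of_mem_nhds {K : Subfield ℝ} {m : ℕ} {t : Fin m → ℝ}
    (ht : AlgebraicIndependent K t) {V : Set (Fin m → ℝ)} (hV : V ∈ 𝓝 t) :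
    ∃ (q : Fin m → ℚ) (r : ℚ) (hsep : ∀ i j, i ≠ j → 2 * (r : ℝ) ≤ |(q i : ℝ) - q j|)
      (htb : t ∈ Metric.ball (fun i => (q i : ℝ)) r),
      (⟨m, q, r, hsep, t, ht, htb⟩ : GenericBall K).carrier ⊆ V := by
  obtain ⟨ε, hε, hεV⟩ := Metric.mem_nhds_iff.mp hV
  have hsmall : ∀ᶠ δ in 𝓝 (0 : ℝ), 2 * δ < ε ∧ ∀ i j, i ≠ j → 4 * δ < |t i - t j| := by
    refine ((continuous_const_mul (2 : ℝ)).tendsto' 0 0 (by simp)).eventually_lt_const hε |>.and ?_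
    simp only [Filter.eventually_all]
    intro i j hij
    refine ((continuous_const_mul (4 : ℝ)).tendsto' 0 0 (by simp)).eventually_lt_const ?_
    exact abs_pos.mpr (sub_ne_zero.mpr (ht.injective.ne hij))
  obtain ⟨δ, ⟨hδε, hδ⟩, hδ0⟩ :=
    ((hsmall.filter_mono nhdsWithin_le_nhds).and (self_mem_nhdsWithin (s := Set.Ioi 0))).exists
  obtain ⟨r, hr0, hrδ⟩ := exists_rat_btwn hδ0
  choose q hq using fun i => exists_rat_near (t i) hr0
  have htb : t ∈ Metric.ball (fun i => (q i : ℝ)) r :=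
    (dist_pi_lt_iff hr0).mpr fun i => by simpa [Real.dist_eq] using hq i
  refine ⟨q, r, fun i j hij => ?_, htb, fun u hu => hεV ?_⟩
  · have h1 := abs_sub_le (t i) (q i) (t j)
    have h2 := abs_sub_le (q i : ℝ) (q j) (t j)
    have h3 := hq i
    have h4 := hq j
    rw [abs_sub_comm] at h4
    linarith [hδ i j hij]
  · rw [Metric.mem_ball]
    have h1 := dist_triangle_right u t (fun i => (q i : ℝ))
    have h2 : dist u (fun i => (q i : ℝ)) < r := hu
    have h3 := Metric.mem_ball.mp htb
    linarith

theorem exists_finite_generic {K : Subfield ℝ} {T : Set ℝ}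
    (hT : IsTranscendenceBasis K ((↑) : T → ℝ)) {X : Set ℝ} (hX : X.Finite) :
    ∃ (m : ℕ) (t : Fin m → T), Function.Injective t ∧
      ∀ a ∈ X, IsAlgebraic (Algebra.adjoin K (Set.range fun i => (t i : ℝ))) a := by
  have hbase := AlgebraicIndependent.matroid_isBase_iff.mpr hT
  obtain ⟨I, hIT, hfin, -, hXI⟩ := Matroid.exists_subset_finite_closure_of_subset_closure hX
    (M := AlgebraicIndependent.matroid K ℝ) (Y := T) (by rw [hbase.closure_eq]; simp)
  rw [AlgebraicIndependent.matroid_closure_eq] at hXI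
  have := hfin.to_subtype
  obtain ⟨m, ⟨e⟩⟩ := Finite.exists_equiv_fin I
  refine ⟨m, fun i => ⟨e.symm i, hIT (e.symm i).2⟩, fun i j h => ?_, fun a ha => ?_⟩
  · exact e.symm.injective (Subtype.ext (congrArg (fun v : T => (v : ℝ)) h))
  · have : Set.range (fun i => (e.symm i : ℝ)) = I := by
      rw [← Function.comp_def, e.symm.surjective.range_comp, Subtype.range_coe]
    rw [this]
    exact hXI ha

theorem exists_admissible {K : Subfield ℝ} {T : Set ℝ}
    (hT : IsTranscendenceBasis K ((↑) : T → ℝ)) {n : ℕ} (x : Fin n → ℝ) :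
    ∃ c : DistanceColor K n, c.Admissible T x := by
  obtain ⟨m, t, htinj, halg⟩ := exists_finite_generic hT (Set.finite_range x)
  have ht : AlgebraicIndependent K (fun i => (t i : ℝ)) := hT.1.comp _ htinj
  have hroot (i : Fin n) : ∃ (P : Polynomial (MvPolynomial (Fin m) K)) (g : (Fin m → ℝ) → ℝ),
      P ≠ 0 ∧ AnalyticAt ℝ g (fun i => (t i : ℝ)) ∧ g (fun i => (t i : ℝ)) = x i ∧
      ∀ᶠ u in 𝓝 (fun i => (t i : ℝ)), P.eval₂ (MvPolynomial.aeval u).toRingHom (g u) = 0 := by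
    obtain ⟨P, hP0, hP1⟩ := (halg (x i) ⟨i, rfl⟩).exists_aeval_derivative_ne_zero
      Subtype.val_injective
    have hcomp : (MvPolynomial.aeval fun i => (t i : ℝ)).toRingHom.comp
        ht.aevalEquiv.symm.toRingEquiv.toRingHom = algebraMap _ ℝ := by
      ext v
      obtain ⟨w, rfl⟩ := ht.aevalEquiv.surjective v
      simp
    let Q := P.map ht.aevalEquiv.symm.toRingEquiv.toRingHom
    have hQ1 : Q.derivative.eval₂ (MvPolynomial.aeval fun i => (t i : ℝ)).toRingHom (x i) ≠ 0 := by
      rwa [Polynomial.derivative_map, Polynomial.eval₂_map, hcomp]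
    obtain ⟨g, hg⟩ := exists_analyticAt_root Q (fun i => (t i : ℝ)) (x i)
      (by rwa [Polynomial.eval₂_map, hcomp]) hQ1
    exact ⟨Q, g, fun h => by simp [h] at hQ1, hg⟩
  choose P g hP hga hgx hPg using hroot
  obtain ⟨q, r, hsep, htb, hb⟩ := GenericBall.exists_subset_of_mem_nhds ht
    (Filter.eventually_all.mpr fun i => (hga i).eventually_analyticAt.and (hPg i))
  let b : GenericBall K := ⟨m, q, r, hsep, _, ht, htb⟩
  let f (i : Fin n) : analyticSubalgebra b.carrier :=
    ⟨fun u => g i u, g i, fun u hu => (hb hu i).1, fun _ => rfl⟩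
  refine ⟨⟨b, fun i => ⟨f i, P i, hP i, ?_⟩⟩, t, htinj, htb, hgx⟩
  refine Subtype.ext (funext fun u => ?_)
  have hcomp : (analyticSubalgebra.eval u).toRingHom.comp
      (algebraMap (MvPolynomial (Fin m) K) (analyticSubalgebra b.carrier)) =
      (MvPolynomial.aeval u.1).toRingHom :=
    RingHom.ext fun p => analyticSubalgebra.eval_algebraMap u p
  change (analyticSubalgebra.eval u).toRingHom (Polynomial.eval₂
    (algebraMap (MvPolynomial (Fin m) K) (analyticSubalgebra b.carrier)) (f i) (P i)) = 0
  rw [Polynomial.hom_eval₂, hcomp]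
  exact (hb u.2 i).2

/-- Corollary 2.7: for any set `D` of positive reals, the
`D`-distance graph on `ℝⁿ` satisfies `χ(X_n(D)) ≤ |D| + ℵ₀`. -/
theorem statement5 (n : ℕ) (hn : 1 ≤ n) (D : Set ℝ) (hD : ∀ r ∈ D, 0 < r) :
    ∃ (C : Type) (f : EuclideanSpace ℝ (Fin n) → C),
      #C ≤ #D + Cardinal.aleph0 ∧
      ∀ x y : EuclideanSpace ℝ (Fin n), ‖x - y‖ ∈ D → f x ≠ f y := by
  let K := Subfield.closure D
  obtain ⟨T, hT⟩ := exists_isTranscendenceBasis K ℝ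
  choose f hf using fun x : Fin n → ℝ => exists_admissible hT x
  refine ⟨DistanceColor K n, fun x => f x, ?_, fun x y hxy heq => ?_⟩
  · rw [Cardinal.add_eq_max' le_rfl]
    refine (mk_distanceColor_le K n).trans (max_le ?_ (le_max_right _ _))
    exact Subfield.cardinalMk_closure_le_max D
  · let d : K := ⟨‖x - y‖, Subfield.subset_closure hxy⟩
    have hd : d ^ 2 ≠ 0 := pow_ne_zero 2 fun h => (hD _ hxy).ne' (congrArg Subtype.val h)
    have hy := hf y
    simp only at heq
    rw [← heq] at hy
    refine (hf x).sum_sq_ne hT.1 hy hd ?_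
    simp [d, EuclideanSpace.norm_sq_eq]
end

section
/- Let P be a simple d-dimensional k-template (d ≥ 1, k ≥ 2), let κ be an infinite cardinal, and let X be a set with |X| ≤ κ^{+(d−1)}. Then χ(L(X^d,P)) ≤ κ. -/
open Cardinal

/-- A set of cardinality at most `κ` embeds into `κ.out` by a function defined everywhere. -/
theorem exists_injOn_out {X : Type} {κ : Cardinal} (hκ : κ ≠ 0) (L : Set X) (hL : #L ≤ κ) :
    ∃ e : X → κ.out, Set.InjOn e L := by
  have : Nonempty κ.out := by
    rw [← Cardinal.mk_ne_zero_iff, Cardinal.mk_out]; exact hκ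
  rw [← Cardinal.mk_out κ, Cardinal.le_def] at hL
  obtain ⟨f⟩ := hL
  refine ⟨Function.extend Subtype.val f fun _ => Classical.arbitrary _, ?_⟩
  intro x hx y hy h
  have hx' := Subtype.val_injective.extend_apply f (fun _ => Classical.arbitrary κ.out) ⟨x, hx⟩
  have hy' := Subtype.val_injective.extend_apply f (fun _ => Classical.arbitrary κ.out) ⟨y, hy⟩
  simp only at hx' hy'
  rw [hx', hy'] at h
  exact congrArg Subtype.val (f.injective h)

/-- A set of cardinality at most `succ c` has a ranking, injective on the set, all of whose
initial segments have cardinality at most `c`. -/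
theorem exists_rank_le {X : Type} (c : Cardinal) (hc : ℵ₀ ≤ c) (S : Set X)
    (hS : #S ≤ Order.succ c) :
    ∃ (β : Type) (_ : LinearOrder β) (f : X → β), ∀ x, #{y | y ∈ S ∧ f y ≤ f x} ≤ c := by
  have hne : (Order.succ c) ≠ 0 := (lt_of_le_of_lt (zero_le) (Order.lt_succ c)).ne'
  obtain ⟨e, he⟩ := exists_injOn_out hne S hS
  have hcard : #(Order.succ c).out = #(Order.succ c).ord.ToType := by simp
  obtain ⟨u⟩ := Cardinal.eq.1 hcard
  refine ⟨(Order.succ c).ord.ToType, inferInstance, fun x => u (e x), fun x => ?_⟩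
  have hseg : #(Set.Iic (u (e x))) ≤ c := by
    rw [← Order.lt_succ_iff, ← Set.Iio_insert]
    refine lt_of_le_of_lt (Cardinal.mk_insert_le) ?_
    refine Cardinal.add_lt_of_lt (hc.trans (Order.le_succ c))
      (by simpa using Cardinal.mk_Iio_lt (u (e x)) (by simp)) ?_
    exact Cardinal.one_lt_aleph0.trans_le (hc.trans (Order.le_succ c))
  refine le_trans (Cardinal.mk_le_of_injective
    (f := fun y : {y | y ∈ S ∧ u (e y) ≤ u (e x)} => (⟨u (e y.1), y.2.2⟩ : Set.Iic (u (e x))))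
    ?_) hseg
  rintro ⟨y, hy⟩ ⟨z, hz⟩ h
  exact Subtype.ext (he hy.1 hz.1 (u.injective (congrArg Subtype.val h)))

theorem aleph0_le_cardSucc {κ : Cardinal} (hκ : ℵ₀ ≤ κ) (n : ℕ) : ℵ₀ ≤ cardSucc κ n := by
  induction n with
  | zero => exact hκ
  | succ n ih =>
    rw [cardSucc, Function.iterate_succ_apply']
    exact ih.trans (Order.le_succ _)

/-- Kuratowski–Sierpiński decomposition: if `#S ≤ κ^{+n}`, then `S ^ (n + 1)` splits into pieces
indexed by the coordinates such that every line in direction `m` meets the `m`-th piece in at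
most `κ` points. -/
theorem exists_line_decomposition {X : Type} {κ : Cardinal} (hκ : ℵ₀ ≤ κ) (n : ℕ) (S : Set X)
    (hS : #S ≤ cardSucc κ n) :
    ∃ g : (Fin (n + 1) → X) → Fin (n + 1), ∀ m a, (∀ i, i ≠ m → a i ∈ S) →
      #{t | t ∈ S ∧ g (Function.update a m t) = m} ≤ κ := by
  induction n generalizing S with
  | zero =>
    exact ⟨fun _ => 0, fun m a _ => (Cardinal.mk_le_mk_of_subset fun t ht => ht.1).trans hS⟩
  | succ n ih =>
    rw [cardSucc, Function.iterate_succ_apply'] at hS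
    obtain ⟨β, _, f, hf⟩ := exists_rank_le _ (aleph0_le_cardSucc hκ n) S hS
    choose G hG using fun x => ih _ (hf x)
    choose J hJ using fun a : Fin (n + 2) → X => Finite.exists_max fun i => f (a i)
    refine ⟨fun a => (J a).succAbove (G (a (J a)) fun i => a ((J a).succAbove i)),
      fun m a ha => ?_⟩
    let T : Fin (n + 1) → Set X := fun j' => {t | t ∈ S ∧ f t ≤ f (a (m.succAbove j')) ∧
      (∀ i, i ≠ m → f (a i) ≤ f (a (m.succAbove j'))) ∧
      (m.succAbove j').succAbove (G (a (m.succAbove j'))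
        fun i => Function.update a m t ((m.succAbove j').succAbove i)) = m}
    have hsub : {t | t ∈ S ∧ (J (Function.update a m t)).succAbove
        (G (Function.update a m t (J (Function.update a m t)))
          fun i => Function.update a m t ((J (Function.update a m t)).succAbove i)) = m} ⊆
        ⋃ j', T j' := by
      rintro t ⟨htS, ht⟩
      have hmax := hJ (Function.update a m t)
      generalize J (Function.update a m t) = j at ht hmax
      have hjm : j ≠ m := by
        rintro rfl
        exact Fin.succAbove_ne _ _ ht
      obtain ⟨j', rfl⟩ := Fin.exists_succAbove_eq hjm
      rw [Function.update_of_ne hjm] at ht hmax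
      refine Set.mem_iUnion.2 ⟨j', htS, by simpa using hmax m, fun i hi => ?_, ht⟩
      simpa [Function.update_of_ne hi] using hmax i
    have hT : ∀ j', #(T j') ≤ κ := by
      intro j'
      rcases (T j').eq_empty_or_nonempty with h | ⟨s, hs⟩
      · rw [h]; simp
      have hmax := hs.2.2.1
      have hjm : m.succAbove j' ≠ m := Fin.succAbove_ne _ _
      obtain ⟨m', hm'⟩ := Fin.exists_succAbove_eq hjm.symm
      refine le_trans (Cardinal.mk_le_mk_of_subset ?_) (hG (a (m.succAbove j')) m'
        (fun i => a ((m.succAbove j').succAbove i)) fun i hi => ?_)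
      · rintro t ⟨htS, hle, -, ht⟩
        refine ⟨⟨htS, hle⟩, ?_⟩
        have hup : (fun i => Function.update a m t ((m.succAbove j').succAbove i)) =
            Function.update (fun i => a ((m.succAbove j').succAbove i)) m' t := by
          have := Function.update_comp_eq_of_injective a
            (Fin.succAbove_right_injective (p := m.succAbove j')) m' t
          rw [hm'] at this
          exact this
        rw [hup] at ht
        exact Fin.succAbove_right_injective (ht.trans hm'.symm)
      · have him : (m.succAbove j').succAbove i ≠ m := fun h =>
          hi (Fin.succAbove_right_injective (h.trans hm'.symm))
        exact ⟨ha _ him, hmax _ him⟩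
    refine (Cardinal.mk_le_mk_of_subset hsub).trans ((Cardinal.mk_iUnion_le_sum_mk).trans ?_)
    refine (Cardinal.sum_le_sum _ _ hT).trans ?_
    rw [Cardinal.sum_const', Cardinal.mk_fin]
    exact (mul_le_mul' (Cardinal.natCast_lt_aleph0.le.trans hκ) le_rfl).trans
      (Cardinal.mul_eq_self hκ).le

/-- If `#X ≤ κ^{+n}`, then `X ^ (n + 1)` has a coloring with at most `κ` colors such that each
color class has a direction in which no two of its points are collinear. -/
theorem exists_coloring_directional {X : Type} {κ : Cardinal} (hκ : ℵ₀ ≤ κ) (n : ℕ)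
    (hX : #X ≤ cardSucc κ n) :
    ∃ (α : Type) (φ : (Fin (n + 1) → X) → α) (dir : α → Fin (n + 1)), #α ≤ κ ∧
      ∀ a b, φ a = φ b → (∀ i, i ≠ dir (φ a) → a i = b i) → a = b := by
  obtain ⟨g, hg⟩ := exists_line_decomposition hκ n (Set.univ : Set X) (by simpa using hX)
  let L : Fin (n + 1) → (Fin (n + 1) → X) → Set X := fun m a => {t | g (Function.update a m t) = m}
  have hL : ∀ m a, #(L m a) ≤ κ := fun m a => by simpa [L] using hg m a fun _ _ => Set.mem_univ _
  choose e he using fun (T : {T : Set X // #T ≤ κ}) =>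
    exists_injOn_out (Cardinal.aleph0_pos.trans_le hκ).ne' T.1 T.2
  refine ⟨Fin (n + 1) × κ.out, fun a => (g a, e ⟨L (g a) a, hL _ _⟩ (a (g a))), Prod.fst, ?_, ?_⟩
  · rw [Cardinal.mk_prod, Cardinal.lift_id, Cardinal.lift_id, Cardinal.mk_out, Cardinal.mk_fin]
    exact (mul_le_mul' (Cardinal.natCast_lt_aleph0.le.trans hκ) le_rfl).trans
      (Cardinal.mul_eq_self hκ).le
  · intro a b h hab
    obtain ⟨h1, h2⟩ := Prod.mk.inj h
    simp only at hab
    rw [← h1] at h2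
    generalize hm : g a = m at *
    have hup : ∀ t, Function.update a m t = Function.update b m t := fun t => by
      funext i
      by_cases hi : i = m
      · subst hi; simp
      · simp [hi, hab i hi]
    have hLab : L m b = L m a := by
      ext t
      simp [L, hup t]
    simp only [hLab] at h2
    have hmab := he ⟨L m a, hL _ _⟩ (by simpa [L] using hm)
      (by simpa [L, hup] using h1.symm) h2
    funext i
    by_cases hi : i = m
    · rw [hi, hmab]
    · exact hab i hi

/-- An edge of a simple template hypergraph contains, for each direction `m`, two vertices that
differ exactly at coordinate `m`. -/
theorem exists_pair_of_isSimple {d k : ℕ} (hk : k ≠ 0) {A : Type} {B : Fin d → Type}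
    {P : Set (Fin d → A)} (hP : P.ncard = k) (hsimple : IsSimple P) {Q : Set (∀ i, B i)}
    (hQ : Q ∈ templateEdges k P) (m : Fin d) :
    ∃ x ∈ Q, ∃ y ∈ Q, x ≠ y ∧ ∀ i, i ≠ m → x i = y i := by
  obtain ⟨hcard, f, hmaps, hsurj, hf⟩ := hQ
  obtain ⟨x, hx, y, hy, hxy⟩ := hsimple m
  have hfin : P.Finite := Set.finite_of_ncard_ne_zero (hP ▸ hk)
  have hinj : Set.InjOn f P := Set.injOn_of_ncard_image_eq
    (by rw [hsurj.image_eq_of_mapsTo hmaps, hcard, hP]) hfin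
  refine ⟨f x, hmaps hx, f y, hmaps hy, fun h => ?_, fun i hi => hf x hx y hy i ((hxy i).2 hi)⟩
  exact (hxy m).1 (congrFun (hinj hx hy h) m) rfl

/-- Lemma 1.4: if `P` is a simple `d`-dimensional
`k`-template, `κ` is infinite and `|X| ≤ κ^{+(d-1)}`, then `χ(L(X^d, P)) ≤ κ`. -/
theorem statement10 (d k : ℕ) (hd : 1 ≤ d) (hk : 2 ≤ k)
    (A : Type) (P : Set (Fin d → A)) (hP : P.ncard = k) (hsimple : IsSimple P)
    (κ : Cardinal) (hκ : Cardinal.aleph0 ≤ κ)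
    (X : Type) (hX : #X ≤ cardSucc κ (d - 1)) :
    chrNum (templateEdges k (B := fun _ : Fin d => X) P) ≤ κ := by
  obtain ⟨n, rfl⟩ : ∃ n, d = n + 1 := ⟨d - 1, by omega⟩
  obtain ⟨α, φ, dir, hα, hφ⟩ := exists_coloring_directional hκ n hX
  refine csInf_le' ⟨α, φ, hα, fun Q hQ => ?_⟩
  by_contra! hmono
  obtain ⟨z, hz, -⟩ := exists_pair_of_isSimple (by omega) hP hsimple hQ 0
  obtain ⟨x, hx, y, hy, hne, hxy⟩ :=
    exists_pair_of_isSimple (by omega) hP hsimple hQ (dir (φ z))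
  exact hne (hφ x y (hmono x hx y hy) (hmono x hx z hz ▸ hxy))
end
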